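/- arXiv:1302.2379 — 6 statements merged into one kernel-verified Lean document; each statement's English description precedes it below -/
import Mathlib

section
/- Let n ≥ 1, F := FreeGroup (Fin n), and Φ : F ≃* F. Suppose (a) Φ has finite order as an outer automorphism: there exist k ≥ 1 and g ∈ F such that Φ^k(x) = g * x * g⁻¹ for all x ∈ F; and (b) the induced automorphism T of the abelianization of F is unipotent: for the endomorphism d of Abelianization F defined by d(a) = T(a) * a⁻¹, there exists m ≥ 1 such that the m-fold composite d ∘ ⋯ ∘ d sends every element to the identity. Then Φ is an inner automorphism: there exists h ∈ F with Φ(x) = h * x * h⁻¹ for all x ∈ F. (Lemma 'finite order' of the paper: a finite-order outer automorphism of a finite-rank free group that is unipotent on H₁(F;ℤ) is trivial.) -/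
open Polynomial

/-- An endomorphism of `G` that induces the identity on the abelianization. -/
def ActsTriviallyOnAb {G : Type*} [Group G] (Ψ : G →* G) : Prop :=
  ∀ x, Abelianization.of (Ψ x) = Abelianization.of x

theorem ActsTriviallyOnAb.hom_apply {G A : Type*} [Group G] [CommGroup A] {Ψ : G →* G}
    (h : ActsTriviallyOnAb Ψ) (f : G →* A) (x : G) : f (Ψ x) = f x := by
  rw [← Abelianization.lift_apply_of f (Ψ x), h x, Abelianization.lift_apply_of]

section AugmentationFiltration

variable {G : Type*} [Group G]

/-- The augmentation ideal of `ℤ[G]`, as a submodule. -/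
noncomputable def augSubmodule (G : Type*) [Group G] : Submodule ℤ (MonoidAlgebra ℤ G) :=
  LinearMap.ker (MonoidAlgebra.lift ℤ ℤ G (1 : G →* ℤ)).toLinearMap

theorem mem_augSubmodule {a : MonoidAlgebra ℤ G} :
    a ∈ augSubmodule G ↔ MonoidAlgebra.lift ℤ ℤ G (1 : G →* ℤ) a = 0 := Iff.rfl

theorem of_sub_one_mem_augSubmodule (x : G) :
    MonoidAlgebra.of ℤ G x - 1 ∈ augSubmodule G := by
  rw [mem_augSubmodule, map_sub, MonoidAlgebra.lift_of, map_one]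
  simp

/-- The homomorphism `x ↦ x - 1` to the additive group `ℤ[G] / I²`. -/
noncomputable def toAugQuotient (G : Type*) [Group G] :
    G →* Multiplicative (MonoidAlgebra ℤ G ⧸ (augSubmodule G) ^ 2) where
  toFun x := Multiplicative.ofAdd (Submodule.Quotient.mk (MonoidAlgebra.of ℤ G x - 1))
  map_one' := by rw [map_one, sub_self, Submodule.Quotient.mk_zero, ofAdd_zero]
  map_mul' x y := by
    rw [← ofAdd_add, ← Submodule.Quotient.mk_add]
    congr 1
    rw [Submodule.Quotient.eq, map_mul]
    have : MonoidAlgebra.of ℤ G x * MonoidAlgebra.of ℤ G y - 1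
        - (MonoidAlgebra.of ℤ G x - 1 + (MonoidAlgebra.of ℤ G y - 1))
        = (MonoidAlgebra.of ℤ G x - 1) * (MonoidAlgebra.of ℤ G y - 1) := by noncomm_ring
    rw [this, sq]
    exact Submodule.mul_mem_mul (of_sub_one_mem_augSubmodule x) (of_sub_one_mem_augSubmodule y)

/-- The endomorphism of `ℤ[G]` induced by an endomorphism of `G`. -/
noncomputable def groupRingMap (Ψ : G →* G) : MonoidAlgebra ℤ G →ₐ[ℤ] MonoidAlgebra ℤ G :=
  MonoidAlgebra.lift ℤ _ G ((MonoidAlgebra.of ℤ G).comp Ψ)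

theorem groupRingMap_of (Ψ : G →* G) (x : G) :
    groupRingMap Ψ (MonoidAlgebra.of ℤ G x) = MonoidAlgebra.of ℤ G (Ψ x) := by
  rw [groupRingMap, MonoidAlgebra.lift_of]; rfl

theorem groupRingMap_iterate_of (Ψ : G →* G) (k : ℕ) (x : G) :
    (groupRingMap Ψ)^[k] (MonoidAlgebra.of ℤ G x) = MonoidAlgebra.of ℤ G (Ψ^[k] x) := by
  induction k generalizing x with
  | zero => rfl
  | succ k ih => rw [Function.iterate_succ_apply, groupRingMap_of, ih, Function.iterate_succ_apply]

theorem ActsTriviallyOnAb.groupRingMap_sub_mem {Ψ : G →* G} (h : ActsTriviallyOnAb Ψ)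
    (a : MonoidAlgebra ℤ G) : groupRingMap Ψ a - a ∈ (augSubmodule G) ^ 2 := by
  induction a using MonoidAlgebra.induction_on with
  | of x =>
    have := h.hom_apply (toAugQuotient G) x
    have := (Submodule.Quotient.eq _).1 (Multiplicative.ofAdd.injective this)
    rw [groupRingMap_of]
    simpa using this
  | add a b ha hb =>
    rw [map_add, add_sub_add_comm]
    exact add_mem ha hb
  | smul c a ha =>
    rw [map_smul, ← smul_sub]
    exact Submodule.smul_mem _ _ ha

theorem groupRingMap_mem_augSubmodule (Ψ : G →* G) {a : MonoidAlgebra ℤ G}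
    (ha : a ∈ augSubmodule G) : groupRingMap Ψ a ∈ augSubmodule G := by
  have : (MonoidAlgebra.lift ℤ ℤ G (1 : G →* ℤ)).comp (groupRingMap Ψ)
      = MonoidAlgebra.lift ℤ ℤ G (1 : G →* ℤ) := by
    ext x
    simp [groupRingMap]
  rw [mem_augSubmodule, ← AlgHom.comp_apply, this]
  exact ha

theorem groupRingMap_mem_augSubmodule_pow (Ψ : G →* G) (k : ℕ) {a : MonoidAlgebra ℤ G}
    (ha : a ∈ (augSubmodule G) ^ k) : groupRingMap Ψ a ∈ (augSubmodule G) ^ k := by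
  have hle : (augSubmodule G).map (groupRingMap Ψ).toLinearMap ≤ augSubmodule G :=
    Submodule.map_le_iff_le_comap.2 fun _ => groupRingMap_mem_augSubmodule Ψ
  have := Submodule.mem_map_of_mem (f := (groupRingMap Ψ).toLinearMap) ha
  rw [Submodule.map_pow] at this
  exact pow_le_pow_left' hle k this

theorem ActsTriviallyOnAb.groupRingMap_sub_mem_pow {Ψ : G →* G} (h : ActsTriviallyOnAb Ψ)
    (k : ℕ) {a : MonoidAlgebra ℤ G} (ha : a ∈ (augSubmodule G) ^ k) :
    groupRingMap Ψ a - a ∈ (augSubmodule G) ^ (k + 1) := by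
  induction k generalizing a with
  | zero =>
    rw [pow_zero] at ha
    obtain ⟨c, rfl⟩ := Submodule.mem_one.1 ha
    rw [AlgHom.commutes, sub_self]
    exact zero_mem _
  | succ k ih =>
    rw [pow_succ] at ha
    induction ha using Submodule.mul_induction_on' with
    | mem_mul_mem a ha b hb =>
      have hb' := groupRingMap_mem_augSubmodule Ψ hb
      have : groupRingMap Ψ (a * b) - a * b
          = (groupRingMap Ψ a - a) * groupRingMap Ψ b + a * (groupRingMap Ψ b - b) := by
        rw [map_mul]; noncomm_ring
      rw [this]
      refine add_mem ?_ ?_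
      · rw [pow_succ]
        exact Submodule.mul_mem_mul (ih ha) hb'
      · rw [add_assoc, pow_add]
        exact Submodule.mul_mem_mul ha (h.groupRingMap_sub_mem b)
    | add a _ b _ ha hb =>
      rw [map_add, add_sub_add_comm]
      exact add_mem ha hb

/-- A conjugation-invariant functional that vanishes on a power of the augmentation ideal is
invariant under every endomorphism that is trivial on the abelianization and has an
inner power. -/
theorem ActsTriviallyOnAb.functional_invariant {Ψ : G →* G} (h : ActsTriviallyOnAb Ψ)
    {k : ℕ} (hk : 1 ≤ k) {g : G} (hg : ∀ x, Ψ^[k] x = g * x * g⁻¹)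
    (φ : MonoidAlgebra ℤ G →ₗ[ℤ] ℤ) (hφ : ∀ a b, φ (a * b) = φ (b * a)) (r : ℕ)
    (hr : ∀ s, r ≤ s → ∀ a ∈ (augSubmodule G) ^ s, φ a = 0) (x : G) :
    φ (MonoidAlgebra.of ℤ G (Ψ x)) = φ (MonoidAlgebra.of ℤ G x) := by
  have hper : ∀ a, φ ((groupRingMap Ψ)^[k] a) = φ a := by
    intro a
    induction a using MonoidAlgebra.induction_on with
    | of x =>
      rw [groupRingMap_iterate_of, hg, map_mul, hφ, ← map_mul]
      simp
    | add a b ha hb => rw [iterate_map_add, map_add, map_add, ha, hb]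
    | smul c a ha => rw [iterate_map_zsmul, map_smul, map_smul, ha]
  have key : ∀ j s, r ≤ s + j → ∀ a ∈ (augSubmodule G) ^ s, φ (groupRingMap Ψ a - a) = 0 := by
    intro j
    induction j with
    | zero =>
      intro s hs a ha
      exact hr (s + 1) (by omega) _ (h.groupRingMap_sub_mem_pow s ha)
    | succ j ih =>
      intro s hs a ha
      have hmem := h.groupRingMap_sub_mem_pow s ha
      have hiter : ∀ i, ∀ c ∈ (augSubmodule G) ^ (s + 1), φ ((groupRingMap Ψ)^[i] c) = φ c := by
        intro i
        induction i with
        | zero => intro c _; rfl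
        | succ i ihi =>
          intro c hc
          have h1 := ih (s + 1) (by omega) c hc
          rw [map_sub, sub_eq_zero] at h1
          rw [Function.iterate_succ_apply, ihi _ ?_, h1]
          exact groupRingMap_mem_augSubmodule_pow Ψ _ hc
      have hlin : ∀ i : ℕ, φ ((groupRingMap Ψ)^[i] a)
          = φ a + i * φ (groupRingMap Ψ a - a) := by
        intro i
        induction i with
        | zero => simp
        | succ i ihi =>
          rw [Function.iterate_succ_apply, ← add_sub_cancel a (groupRingMap Ψ a), iterate_map_add,
            map_add, ihi, hiter i _ hmem, add_sub_cancel]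
          push_cast
          ring
      have h3 := hlin k
      rw [hper, left_eq_add, mul_eq_zero] at h3
      exact h3.resolve_left (by exact_mod_cast (by omega : k ≠ 0))
  have h1 := key r 1 (by omega) _ (by rw [pow_one]; exact of_sub_one_mem_augSubmodule x)
  rw [map_sub (groupRingMap Ψ), map_one, sub_sub_sub_cancel_right, map_sub, sub_eq_zero,
    groupRingMap_of] at h1
  exact h1

end AugmentationFiltration

section MagnusRepresentation

variable {ι M : Type*} [Ring M]

/-- A square-zero element stays square-zero, up to integer multiples, after multiplying by `X`. -/
theorem C_zsmul_mul_X_mul_self {a : M} (ha : a * a = 0) (e : ℤ) :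
    C (e • a) * X * (C a * X) = (0 : M[X]) := by
  rw [mul_assoc, ← mul_assoc X, X_mul_C, mul_assoc, ← mul_assoc, ← C_mul, smul_mul_assoc, ha,
    smul_zero, C_0, zero_mul]

/-- For a square-zero element `a`, the unit `1 + aX` of the polynomial ring. -/
noncomputable def oneAddUnit (a : M) (ha : a * a = 0) : (M[X])ˣ where
  val := 1 + C a * X
  inv := 1 - C a * X
  val_inv := by
    have : C a * X * (C a * X) = (0 : M[X]) := by
      simpa only [one_smul] using C_zsmul_mul_X_mul_self ha 1
    rw [add_mul, mul_sub, mul_sub, this]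
    simp
  inv_val := by
    have : C a * X * (C a * X) = (0 : M[X]) := by
      simpa only [one_smul] using C_zsmul_mul_X_mul_self ha 1
    rw [sub_mul, mul_add, mul_add, this]
    simp

theorem coe_oneAddUnit_zpow (a : M) (ha : a * a = 0) (e : ℤ) :
    ((oneAddUnit a ha ^ e : (M[X])ˣ) : M[X]) = 1 + C (e • a) * X := by
  have hsq := C_zsmul_mul_X_mul_self ha
  induction e using Int.induction_on with
  | zero => simp
  | succ e ih =>
    rw [zpow_add_one, Units.val_mul, ih]
    change (1 + C ((e : ℤ) • a) * X) * (1 + C a * X) = _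
    rw [add_mul, mul_add, mul_add, hsq, add_smul, one_smul, C_add, add_mul]
    simp only [one_mul, mul_one, add_zero]
    abel
  | pred e ih =>
    rw [zpow_sub_one, Units.val_mul, ih]
    change (1 + C ((-e : ℤ) • a) * X) * (1 - C a * X) = _
    rw [add_mul, mul_sub, mul_sub, hsq, sub_smul, one_smul, C_sub, sub_mul]
    simp only [one_mul, mul_one, sub_zero]
    abel

/-- The Magnus-type representation `xᵢ ↦ 1 + NᵢX` attached to square-zero elements `Nᵢ`. -/
noncomputable def magnusHom (N : ι → M) (hN : ∀ i, N i * N i = 0) : FreeGroup ι →* M[X] :=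
  (Units.coeHom _).comp (FreeGroup.lift fun i => oneAddUnit (N i) (hN i))

/-- The product of a list of syllables, where `(i, e)` stands for `xᵢ ^ e`. -/
def syllableProd (L : List (ι × ℤ)) : FreeGroup ι :=
  (L.map fun p => FreeGroup.of p.1 ^ p.2).prod

@[simp] theorem syllableProd_nil : syllableProd ([] : List (ι × ℤ)) = 1 := rfl

@[simp] theorem syllableProd_cons (p : ι × ℤ) (L : List (ι × ℤ)) :
    syllableProd (p :: L) = FreeGroup.of p.1 ^ p.2 * syllableProd L := by
  simp [syllableProd]

@[simp] theorem syllableProd_append (L L' : List (ι × ℤ)) :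
    syllableProd (L ++ L') = syllableProd L * syllableProd L' := by
  simp [syllableProd]

theorem exists_syllableProd_eq (x : FreeGroup ι) : ∃ L, syllableProd L = x := by
  induction x using FreeGroup.induction_on with
  | C1 => exact ⟨[], rfl⟩
  | of i => exact ⟨[(i, 1)], by simp⟩
  | inv_of i _ => exact ⟨[(i, -1)], by simp⟩
  | mul x y hx hy =>
    obtain ⟨L, rfl⟩ := hx
    obtain ⟨L', rfl⟩ := hy
    exact ⟨L ++ L', syllableProd_append L L'⟩

variable (N : ι → M) (hN : ∀ i, N i * N i = 0)

theorem magnusHom_of_zpow (i : ι) (e : ℤ) :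
    magnusHom N hN (FreeGroup.of i ^ e) = 1 + C (e • N i) * X := by
  rw [← coe_oneAddUnit_zpow (N i) (hN i)]
  simp [magnusHom]

theorem coeff_magnusHom_syllableProd_of_lt (L : List (ι × ℤ)) {k : ℕ} (hk : L.length < k) :
    (magnusHom N hN (syllableProd L)).coeff k = 0 := by
  induction L generalizing k with
  | nil => simp [coeff_one]; simp at hk; omega
  | cons p L ih =>
    obtain ⟨k, rfl⟩ : ∃ m, k = m + 1 := ⟨k - 1, by omega⟩
    rw [List.length_cons] at hk
    rw [syllableProd_cons, map_mul, magnusHom_of_zpow, add_mul, one_mul, coeff_add, mul_assoc,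
      coeff_C_mul, coeff_X_mul, ih (by omega), ih (by omega), mul_zero, add_zero]

theorem coeff_magnusHom_syllableProd_length (L : List (ι × ℤ)) :
    (magnusHom N hN (syllableProd L)).coeff L.length = (L.map fun p => p.2 • N p.1).prod := by
  induction L with
  | nil => simp
  | cons p L ih =>
    rw [syllableProd_cons, map_mul, magnusHom_of_zpow, add_mul, one_mul, List.length_cons,
      coeff_add, mul_assoc, coeff_C_mul, coeff_X_mul, ih,
      coeff_magnusHom_syllableProd_of_lt N hN L (Nat.lt_succ_self _), zero_add, List.map_cons,
      List.prod_cons]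

theorem coeff_zero_magnusHom (x : FreeGroup ι) : (magnusHom N hN x).coeff 0 = 1 := by
  obtain ⟨L, rfl⟩ := exists_syllableProd_eq x
  induction L with
  | nil => simp
  | cons p L ih =>
    rw [syllableProd_cons, map_mul, magnusHom_of_zpow, mul_coeff_zero, ih]
    simp

/-- The functional on `ℤ[F]` obtained by applying `τ` to the `r`-th coefficient of the
Magnus-type representation. -/
noncomputable def magnusFunctional (τ : M →ₗ[ℤ] ℤ) (r : ℕ) :
    MonoidAlgebra ℤ (FreeGroup ι) →ₗ[ℤ] ℤ :=
  τ ∘ₗ (lcoeff M r).restrictScalars ℤ ∘ₗ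
    (MonoidAlgebra.lift ℤ M[X] (FreeGroup ι) (magnusHom N hN)).toLinearMap

theorem magnusFunctional_apply (τ : M →ₗ[ℤ] ℤ) (r : ℕ) (a : MonoidAlgebra ℤ (FreeGroup ι)) :
    magnusFunctional N hN τ r a
      = τ ((MonoidAlgebra.lift ℤ M[X] (FreeGroup ι) (magnusHom N hN) a).coeff r) := rfl

theorem magnusFunctional_of (τ : M →ₗ[ℤ] ℤ) (r : ℕ) (x : FreeGroup ι) :
    magnusFunctional N hN τ r (MonoidAlgebra.of ℤ _ x) = τ ((magnusHom N hN x).coeff r) := by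
  rw [magnusFunctional_apply, MonoidAlgebra.lift_of]

theorem magnusFunctional_mul_comm (τ : M →ₗ[ℤ] ℤ) (hτ : ∀ a b, τ (a * b) = τ (b * a)) (r : ℕ)
    (a b : MonoidAlgebra ℤ (FreeGroup ι)) :
    magnusFunctional N hN τ r (a * b) = magnusFunctional N hN τ r (b * a) := by
  simp only [magnusFunctional_apply, map_mul, coeff_mul, map_sum]
  rw [← Finset.Nat.sum_antidiagonal_swap]
  exact Finset.sum_congr rfl fun _ _ => hτ _ _

theorem X_pow_dvd_lift_magnusHom (s : ℕ) {a : MonoidAlgebra ℤ (FreeGroup ι)}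
    (ha : a ∈ (augSubmodule (FreeGroup ι)) ^ s) :
    X ^ s ∣ MonoidAlgebra.lift ℤ M[X] (FreeGroup ι) (magnusHom N hN) a := by
  induction s generalizing a with
  | zero => rw [pow_zero]; exact one_dvd _
  | succ s ih =>
    rw [pow_succ] at ha
    induction ha using Submodule.mul_induction_on' with
    | mem_mul_mem a ha b hb =>
      have hX : X ∣ MonoidAlgebra.lift ℤ M[X] (FreeGroup ι) (magnusHom N hN) b := by
        have : ∀ c, (MonoidAlgebra.lift ℤ M[X] (FreeGroup ι) (magnusHom N hN) c).coeff 0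
            = ((MonoidAlgebra.lift ℤ ℤ _ (1 : FreeGroup ι →* ℤ) c : ℤ) : M) := by
          intro c
          induction c using MonoidAlgebra.induction_on with
          | of x =>
            rw [MonoidAlgebra.lift_of, MonoidAlgebra.lift_of, coeff_zero_magnusHom,
              MonoidHom.one_apply, Int.cast_one]
          | add a b ha hb => rw [map_add, map_add, coeff_add, ha, hb, Int.cast_add]
          | smul n a ha => rw [map_smul, map_smul, coeff_smul, ha, smul_eq_mul, Int.cast_mul,
              zsmul_eq_mul]
        rw [X_dvd_iff, this, mem_augSubmodule.1 hb, Int.cast_zero]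
      obtain ⟨p, hp⟩ := ih ha
      obtain ⟨q, hq⟩ := hX
      refine ⟨p * q, ?_⟩
      rw [map_mul, hp, hq, pow_succ, mul_assoc, mul_assoc, ← mul_assoc p, ← X_mul, mul_assoc]
    | add a _ b _ ha hb =>
      rw [map_add]
      exact dvd_add ha hb

theorem magnusFunctional_eq_zero (τ : M →ₗ[ℤ] ℤ) {r s : ℕ} (hs : r < s)
    {a : MonoidAlgebra ℤ (FreeGroup ι)} (ha : a ∈ (augSubmodule (FreeGroup ι)) ^ s) :
    magnusFunctional N hN τ r a = 0 := by
  rw [magnusFunctional_apply, X_pow_dvd_iff.1 (X_pow_dvd_lift_magnusHom N hN s ha) r hs, map_zero]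

end MagnusRepresentation

section CyclicTrace

variable {ι : Type*} [DecidableEq ι]

/-- The part, labelled by `i`, of the adjacency matrix of the cyclic quiver whose `s`-th arrow
has label `c s`. -/
def cyclicMatrix {r : ℕ} [NeZero r] (c : Fin r → ι) (i : ι) : Matrix (Fin r) (Fin r) ℤ :=
  Matrix.of fun s t => if c s = i ∧ t = s + 1 then 1 else 0

theorem cyclicMatrix_mul_self {r : ℕ} [NeZero r] {c : Fin r → ι} (hc : ∀ s, c s ≠ c (s + 1))
    (i : ι) : cyclicMatrix c i * cyclicMatrix c i = 0 := by
  ext s t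
  rw [Matrix.mul_apply]
  refine Finset.sum_eq_zero fun u _ => ?_
  simp only [cyclicMatrix, Matrix.of_apply, mul_ite, mul_one, mul_zero]
  split_ifs with h1 h2
  · exact absurd (h2.1.trans h1.1.symm) (by rw [h2.2]; exact hc s)
  · rfl
  · rfl

theorem cyclicMatrix_prod_nonneg {r : ℕ} [NeZero r] (c : Fin r → ι) (l : List ι) (s t : Fin r) :
    0 ≤ (l.map (cyclicMatrix c)).prod s t := by
  induction l generalizing s with
  | nil => simp [Matrix.one_apply]; split_ifs <;> simp
  | cons i l ih =>
    rw [List.map_cons, List.prod_cons, Matrix.mul_apply]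
    refine Finset.sum_nonneg fun u _ => mul_nonneg ?_ (ih u)
    simp only [cyclicMatrix, Matrix.of_apply]
    split_ifs <;> simp

theorem cyclicMatrix_prod_path {r : ℕ} [NeZero r] (c : Fin r → ι) (l : List ι) (s : Fin r)
    (hl : ∀ k (hk : k < l.length), l[k] = c (s + Fin.ofNat r k)) :
    1 ≤ (l.map (cyclicMatrix c)).prod s (s + Fin.ofNat r l.length) := by
  induction l generalizing s with
  | nil => simp
  | cons i l ih =>
    rw [List.map_cons, List.prod_cons, Matrix.mul_apply]
    have h0 : i = c s := hl 0 (by simp) |>.trans (by simp)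
    have hnat : ∀ k, s + 1 + Fin.ofNat r k = s + Fin.ofNat r (k + 1) := by
      intro k
      rw [add_assoc]
      congr 1
      ext
      simp [Fin.val_add, add_comm]
    refine le_trans ?_ (Finset.single_le_sum (fun u _ => mul_nonneg ?_ ?_)
      (Finset.mem_univ (s + 1)))
    · have := ih (s + 1) fun k hk => by
        rw [hnat]
        exact hl (k + 1) (by simpa using hk)
      rw [hnat] at this
      simpa [cyclicMatrix, h0] using this
    · simp only [cyclicMatrix, Matrix.of_apply]
      split_ifs <;> simp
    · exact cyclicMatrix_prod_nonneg c l _ _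

theorem one_le_trace_cyclicMatrix_prod {r : ℕ} [NeZero r] (c : Fin r → ι) :
    1 ≤ ((List.ofFn c).map (cyclicMatrix c)).prod.trace := by
  have h := cyclicMatrix_prod_path c (List.ofFn c) 0 (by
    intro k hk
    simp only [List.getElem_ofFn, zero_add]
    congr 1
    ext
    simp at hk
    simp [Nat.mod_eq_of_lt hk])
  refine le_trans ?_ (Finset.single_le_sum (fun u _ => ?_) (Finset.mem_univ (0 : Fin r)))
  · simpa using h
  · exact cyclicMatrix_prod_nonneg c _ _ _

end CyclicTrace

section SyllableLength

variable {ι : Type*}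

/-- Consecutive syllables of the cyclic word `p :: l` are powers of distinct generators, and
no syllable is trivial. -/
def IsCyclicNormalForm (p : ι × ℤ) (l : List (ι × ℤ)) : Prop :=
  (∀ q ∈ p :: l, q.2 ≠ 0) ∧ ((p :: l ++ [p]).map Prod.fst).IsChain (· ≠ ·)

/-- The endomorphism `Ψ` never increases the cyclic syllable length. -/
def NonLengthening (Ψ : FreeGroup ι →* FreeGroup ι) : Prop :=
  ∀ (L : List (ι × ℤ)) (p : ι × ℤ) (l : List (ι × ℤ)), L.length < (p :: l).length →
    IsCyclicNormalForm p l → ¬ IsConj (Ψ (syllableProd L)) (syllableProd (p :: l))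

theorem prod_map_zsmul {M : Type*} [Ring M] (N : ι → M) (L : List (ι × ℤ)) :
    (L.map fun p => p.2 • N p.1).prod
      = (L.map Prod.snd).prod • ((L.map Prod.fst).map N).prod := by
  induction L with
  | nil => simp
  | cons p L ih => simp only [List.map_cons, List.prod_cons, ih, smul_mul_smul_comm]

theorem ActsTriviallyOnAb.nonLengthening {Ψ : FreeGroup ι →* FreeGroup ι}
    (h : ActsTriviallyOnAb Ψ) {k : ℕ} (hk : 1 ≤ k) {g : FreeGroup ι}
    (hg : ∀ x, Ψ^[k] x = g * x * g⁻¹) : NonLengthening Ψ := by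
  classical
  intro L' p l hlen hnf hconj
  obtain ⟨hne, hchain⟩ := hnf
  obtain ⟨L, hL⟩ : ∃ L, p :: l = L := ⟨_, rfl⟩
  rw [hL] at hlen hconj hne hchain
  have hpos : 0 < L.length := by simp [← hL]
  have : NeZero L.length := ⟨hpos.ne'⟩
  set c : Fin L.length → ι := fun s => (L.get s).1 with hc
  have hcyc : ∀ s, c s ≠ c (s + 1) := by
    intro s
    have hs := List.isChain_iff_getElem.1 hchain s (by simp)
    simp only [List.getElem_map] at hs
    rw [List.getElem_append_left s.2] at hs
    by_cases hs1 : (s : ℕ) + 1 < L.length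
    · rw [List.getElem_append_left hs1] at hs
      have : ((s + 1 : Fin L.length) : ℕ) = s + 1 := Fin.val_add_one_of_lt' hs1
      simpa [hc, this] using hs
    · have hs2 : (s : ℕ) + 1 = L.length := by omega
      rw [List.getElem_append_right (by omega)] at hs
      have : s + 1 = 0 := by
        ext
        simp [Fin.val_add, hs2]
      rw [this]
      subst hL
      simpa [hc] using hs
  have hN := cyclicMatrix_mul_self hcyc
  set τ := Matrix.traceLinearMap (Fin L.length) ℤ ℤ
  have hτ : ∀ a b, τ (a * b) = τ (b * a) := fun a b => Matrix.trace_mul_comm a b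
  have hcomm := magnusFunctional_mul_comm (cyclicMatrix c) hN τ hτ L.length
  have hinv := h.functional_invariant hk hg (magnusFunctional (cyclicMatrix c) hN τ L.length)
    hcomm (L.length + 1)
    (fun s hs a ha => magnusFunctional_eq_zero (cyclicMatrix c) hN τ (by omega) ha)
    (syllableProd L')
  obtain ⟨u, hu⟩ := isConj_iff.1 hconj
  have hclass : magnusFunctional (cyclicMatrix c) hN τ L.length
      (MonoidAlgebra.of ℤ _ (syllableProd L)) = magnusFunctional (cyclicMatrix c) hN τ L.length
      (MonoidAlgebra.of ℤ _ (Ψ (syllableProd L'))) := by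
    rw [← hu, map_mul, hcomm, ← map_mul]
    simp
  rw [hinv, magnusFunctional_of, magnusFunctional_of, coeff_magnusHom_syllableProd_length,
    coeff_magnusHom_syllableProd_of_lt _ _ _ hlen, map_zero, prod_map_zsmul, map_smul,
    smul_eq_mul, mul_eq_zero] at hclass
  have hfn : List.ofFn c = L.map Prod.fst := by
    refine List.ext_getElem (by simp) fun s _ _ => ?_
    simp [hc]
  have htr := one_le_trace_cyclicMatrix_prod c
  rw [hfn] at htr
  rcases hclass with h0 | h0
  · rw [List.prod_eq_zero_iff, List.mem_map] at h0
    obtain ⟨q, hq, hq0⟩ := h0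
    exact hne q hq hq0
  · have h1 : ((L.map Prod.fst).map (cyclicMatrix c)).prod.trace = 0 := h0
    omega

theorem NonLengthening.conj_comp {Ψ : FreeGroup ι →* FreeGroup ι} (h : NonLengthening Ψ)
    (g : FreeGroup ι) : NonLengthening ((MulAut.conj g).toMonoidHom.comp Ψ) := by
  intro L p l hlen hnf hconj
  refine h L p l hlen hnf (IsConj.trans ?_ hconj)
  exact isConj_iff.2 ⟨g, rfl⟩

theorem ActsTriviallyOnAb.conj_comp {G : Type*} [Group G] {Ψ : G →* G}
    (h : ActsTriviallyOnAb Ψ) (g : G) :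
    ActsTriviallyOnAb ((MulAut.conj g).toMonoidHom.comp Ψ) := by
  intro x
  rw [← h x]
  simp

theorem syllableProd_erase_zero {u v : List (ι × ℤ)} {q : ι × ℤ} (hq : q.2 = 0) :
    syllableProd (u ++ q :: v) = syllableProd (u ++ v) := by
  simp [hq]

theorem syllableProd_merge {u v : List (ι × ℤ)} {p q : ι × ℤ} (hpq : p.1 = q.1) :
    syllableProd (u ++ p :: q :: v) = syllableProd (u ++ (p.1, p.2 + q.2) :: v) := by
  simp [hpq, zpow_add, mul_assoc]

theorem isConj_syllableProd_append_comm (u v : List (ι × ℤ)) :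
    IsConj (syllableProd (u ++ v)) (syllableProd (v ++ u)) :=
  isConj_iff.2 ⟨syllableProd v, by simp [mul_assoc]⟩

/-- The syllables of the inverse word. -/
def invSyllables (l : List (ι × ℤ)) : List (ι × ℤ) :=
  (l.map fun q => (q.1, -q.2)).reverse

@[simp] theorem syllableProd_invSyllables (l : List (ι × ℤ)) :
    syllableProd (invSyllables l) = (syllableProd l)⁻¹ := by
  induction l with
  | nil => simp [invSyllables]
  | cons p l ih =>
    have : invSyllables (p :: l) = invSyllables l ++ [(p.1, -p.2)] := by simp [invSyllables]
    rw [this, syllableProd_append, ih]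
    simp

theorem map_fst_invSyllables (l : List (ι × ℤ)) :
    (invSyllables l).map Prod.fst = (l.map Prod.fst).reverse := by
  simp [invSyllables, Function.comp_def]

/-- If some list satisfies `P`, then some list of minimal length does. -/
theorem exists_minimal_length {α : Type*} {P : List α → Prop} (h : ∃ l, P l) :
    ∃ l, P l ∧ ∀ l', P l' → l.length ≤ l'.length := by
  obtain ⟨l, hl, hmin⟩ := WellFounded.has_min (measure (List.length (α := α))).wf {l | P l} h
  exact ⟨l, hl, fun l' hl' => not_lt.1 (hmin l' hl')⟩

/-- Every element of a free group is conjugate to a cyclic normal form or to a power of a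
generator. -/
theorem exists_isConj_syllableProd (x : FreeGroup ι) :
    ∃ L, IsConj x (syllableProd L) ∧
      (L.length ≤ 1 ∨ ∃ p l, L = p :: l ∧ IsCyclicNormalForm p l) := by
  obtain ⟨L, hL, hmin⟩ := exists_minimal_length (P := fun L => IsConj x (syllableProd L))
    (by
      obtain ⟨L, rfl⟩ := exists_syllableProd_eq x
      exact ⟨L, IsConj.refl _⟩)
  refine ⟨L, hL, or_iff_not_imp_left.2 fun hlen => ?_⟩
  obtain ⟨p, l, rfl⟩ : ∃ p l, L = p :: l := by
    cases L with
    | nil => simp at hlen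
    | cons p l => exact ⟨p, l, rfl⟩
  refine ⟨p, l, rfl, ?_, ?_⟩
  · intro q hq hq0
    obtain ⟨u, v, huv⟩ := List.append_of_mem hq
    rw [huv] at hL hmin
    rw [syllableProd_erase_zero hq0] at hL
    have := hmin _ hL
    simp at this
  · rw [List.isChain_map, List.isChain_iff_forall_rel_of_append_cons_cons]
    intro a b u v huv hab
    rcases List.eq_nil_or_concat v with rfl | ⟨v, c, rfl⟩
    · have h1 : (p :: l) ++ [p] = (u ++ [a]) ++ [b] := by simpa using huv
      obtain ⟨h2, h3⟩ := List.append_inj' h1 rfl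
      obtain rfl : p = b := by simpa using h3
      cases u with
      | nil =>
        obtain ⟨-, rfl⟩ : p = a ∧ l = [] := by simpa using h2
        simp at hlen
      | cons p' u =>
        obtain ⟨rfl, rfl⟩ : p = p' ∧ l = u ++ [a] := by simpa using h2
        have h4 := hL.trans (isConj_syllableProd_append_comm (p :: u) [a])
        have h5 := syllableProd_merge (u := []) (v := u) hab
        rw [List.nil_append] at h5
        rw [List.singleton_append, h5] at h4
        have := hmin _ h4
        simp at this
    · have h1 : (p :: l) ++ [p] = (u ++ a :: b :: v) ++ [c] := by simpa using huv
      obtain ⟨h2, -⟩ := List.append_inj' h1 rfl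
      rw [h2] at hL hmin
      rw [syllableProd_merge hab] at hL
      have := hmin _ hL
      simp at this

/-- An endomorphism that is trivial on the abelianization and does not lengthen cyclic words
sends each generator to a conjugate of itself. -/
theorem NonLengthening.isConj_of {Ψ : FreeGroup ι →* FreeGroup ι} (h : NonLengthening Ψ)
    (hab : ActsTriviallyOnAb Ψ) (i : ι) :
    ∃ g, Ψ (FreeGroup.of i) = g * FreeGroup.of i * g⁻¹ := by
  classical
  obtain ⟨L, hL, hcase⟩ := exists_isConj_syllableProd (Ψ (FreeGroup.of i))
  have hlen : L.length ≤ 1 := by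
    refine hcase.elim id ?_
    rintro ⟨p, l, rfl, hnf⟩
    by_contra hlt
    refine h [(i, 1)] p l (by simpa [List.length_pos_iff] using hlt) hnf ?_
    simpa using hL
  obtain ⟨u, hu⟩ := isConj_iff.1 hL
  set f : FreeGroup ι →* Multiplicative ℤ :=
    FreeGroup.lift fun k => Multiplicative.ofAdd (if k = i then 1 else 0)
  have hf : f (FreeGroup.of i) = f (syllableProd L) := by
    rw [← hu, map_mul, map_mul, map_inv, hab.hom_apply, mul_right_comm, mul_inv_cancel, one_mul]
  have hfi : f (FreeGroup.of i) = Multiplicative.ofAdd 1 := by simp [f]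
  rw [hfi] at hf
  match L, hlen with
  | [], _ => simp at hf
  | [(j, e)], _ =>
    have hj : f (FreeGroup.of j) = Multiplicative.ofAdd (if j = i then 1 else 0) := by simp [f]
    rw [syllableProd_cons, syllableProd_nil, mul_one, map_zpow, hj, ← ofAdd_zsmul] at hf
    have hf' := Multiplicative.ofAdd.injective hf
    by_cases hji : j = i
    · subst hji
      obtain rfl : 1 = e := by simpa using hf'
      refine ⟨u⁻¹, ?_⟩
      simp only [syllableProd_cons, syllableProd_nil, mul_one, zpow_one] at hu
      rw [inv_inv, mul_assoc, eq_inv_mul_iff_mul_eq, ← mul_inv_eq_iff_eq_mul]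
      exact hu
    · simp [hji] at hf'

/-- If a non-lengthening endomorphism fixes `xᵢ` and sends `xⱼ` to a conjugate, then the
conjugator may be taken to be a power of `xᵢ`. -/
theorem NonLengthening.exists_zpow_conj {Ψ : FreeGroup ι →* FreeGroup ι}
    (h : NonLengthening Ψ) {i j : ι} (hi : Ψ (FreeGroup.of i) = FreeGroup.of i)
    (hj : ∃ g, Ψ (FreeGroup.of j) = g * FreeGroup.of j * g⁻¹) :
    ∃ a : ℤ, Ψ (FreeGroup.of j) = FreeGroup.of i ^ a * FreeGroup.of j * (FreeGroup.of i ^ a)⁻¹ := by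
  obtain ⟨g, hg⟩ := hj
  obtain ⟨l, ⟨a, b, hab⟩, hmin⟩ := exists_minimal_length
    (P := fun l => ∃ a b : ℤ, g = FreeGroup.of i ^ a * syllableProd l * FreeGroup.of j ^ b) (by
      obtain ⟨L, rfl⟩ := exists_syllableProd_eq g
      exact ⟨L, 0, 0, by simp⟩)
  have hconj : Ψ (FreeGroup.of j) = FreeGroup.of i ^ a * syllableProd l * FreeGroup.of j *
      (syllableProd l)⁻¹ * (FreeGroup.of i ^ a)⁻¹ := by
    rw [hg, hab]
    group
  rcases eq_or_ne l [] with rfl | hl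
  · exact ⟨a, by simpa using hconj⟩
  exfalso
  have hchain : (((i, (1 : ℤ)) :: (l ++ [(j, 1)])).map Prod.fst).IsChain (· ≠ ·) := by
    rw [List.isChain_map, List.isChain_iff_forall_rel_of_append_cons_cons]
    intro p q u v huv hpq
    cases u with
    | nil =>
      obtain ⟨q', l, rfl⟩ := List.exists_cons_of_ne_nil hl
      obtain ⟨rfl, rfl, -⟩ : (i, (1 : ℤ)) = p ∧ q' = q ∧ l ++ [(j, 1)] = v := by simpa using huv
      have := hmin l ⟨a + q'.2, b, by
        rw [hab, zpow_add, syllableProd_cons, ← hpq]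
        simp only [mul_assoc]⟩
      simp at this
    | cons p' u =>
      obtain ⟨-, huv⟩ : (i, (1 : ℤ)) = p' ∧ l ++ [(j, 1)] = u ++ p :: q :: v := by
        simpa using huv
      rcases List.eq_nil_or_concat v with rfl | ⟨v, c, rfl⟩
      · have h1 : l ++ [(j, 1)] = (u ++ [p]) ++ [q] := by simpa using huv
        obtain ⟨rfl, h3⟩ := List.append_inj' h1 rfl
        obtain rfl : (j, 1) = q := by simpa using h3
        have := hmin u ⟨a, p.2 + b, by
          rw [hab, zpow_add, syllableProd_append, syllableProd_cons, syllableProd_nil, mul_one,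
            hpq]
          simp only [mul_assoc]⟩
        simp at this
      · have h1 : l ++ [(j, 1)] = (u ++ p :: q :: v) ++ [c] := by simpa using huv
        obtain ⟨rfl, -⟩ := List.append_inj' h1 rfl
        rw [syllableProd_merge hpq] at hab
        have := hmin _ ⟨a, b, hab⟩
        simp at this
  have hne : ∀ q ∈ l, q.2 ≠ 0 := by
    intro q hq hq0
    obtain ⟨u, v, rfl⟩ := List.append_of_mem hq
    rw [syllableProd_erase_zero hq0] at hab
    have := hmin _ ⟨a, b, hab⟩
    simp at this
  refine h [(i, 1), (j, 1)] (i, 1) (l ++ (j, 1) :: invSyllables l) ?_ ⟨?_, ?_⟩ ?_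
  · have := List.length_pos_iff.2 hl
    simp [invSyllables]
    omega
  · intro q hq
    simp only [List.mem_cons, List.mem_append, invSyllables, List.mem_reverse, List.mem_map] at hq
    rcases hq with rfl | hq | rfl | ⟨q, hq, rfl⟩
    · simp
    · exact hne q hq
    · simp
    · simpa using hne q hq
  · have hrev := List.isChain_reverse.2 (hchain.imp fun _ _ => Ne.symm)
    simp only [List.map_cons, List.map_append, List.map_nil, List.cons_append, List.append_assoc,
      List.reverse_cons, List.reverse_append, List.reverse_nil, List.nil_append,
      map_fst_invSyllables] at hchain hrev ⊢
    exact List.isChain_cons_split.2 ⟨hchain, hrev⟩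
  · rw [isConj_comm, isConj_iff]
    refine ⟨FreeGroup.of i ^ a, ?_⟩
    simp only [syllableProd_cons, syllableProd_append, syllableProd_invSyllables,
      syllableProd_nil, zpow_one, mul_one, map_mul, hi, hconj]
    simp only [← mul_assoc]
    rw [← zpow_add_one, ← zpow_one_add, add_comm]

theorem NonLengthening.eq_inner {Ψ : FreeGroup ι →* FreeGroup ι} (h : NonLengthening Ψ)
    (hab : ActsTriviallyOnAb Ψ) : ∃ g, ∀ x, Ψ x = g * x * g⁻¹ := by
  have hfix : ∀ {Ψ : FreeGroup ι →* FreeGroup ι}, (∀ i, Ψ (FreeGroup.of i) = FreeGroup.of i) →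
      ∃ g, ∀ x, Ψ x = g * x * g⁻¹ := by
    intro Ψ hΨ
    have : Ψ = MonoidHom.id _ := FreeGroup.ext_hom _ _ hΨ
    exact ⟨1, by simp [this]⟩
  have hconj : ∀ {Ψ : FreeGroup ι →* FreeGroup ι} (u : FreeGroup ι),
      (∃ g, ∀ x, (MulAut.conj u).toMonoidHom.comp Ψ x = g * x * g⁻¹) →
      ∃ g, ∀ x, Ψ x = g * x * g⁻¹ := by
    rintro Ψ u ⟨g, hg⟩
    refine ⟨u⁻¹ * g, fun x => ?_⟩
    have h1 : u * Ψ x * u⁻¹ = g * x * g⁻¹ := hg x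
    calc Ψ x = u⁻¹ * (u * Ψ x * u⁻¹) * u := by group
      _ = _ := by rw [h1]; group
  rcases isEmpty_or_nonempty ι with hι | ⟨⟨i⟩⟩
  · exact hfix fun i => isEmptyElim i
  obtain ⟨u, hu⟩ := h.isConj_of hab i
  apply hconj u⁻¹
  have h₁ := h.conj_comp u⁻¹
  have hab₁ := hab.conj_comp u⁻¹
  have hi₁ : (MulAut.conj u⁻¹).toMonoidHom.comp Ψ (FreeGroup.of i) = FreeGroup.of i := by
    simp [hu, mul_assoc]
  generalize (MulAut.conj u⁻¹).toMonoidHom.comp Ψ = Ψ₁ at h₁ hab₁ hi₁ ⊢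
  by_cases hsub : ∀ j, j = i
  · exact hfix fun j => by rw [hsub j, hi₁]
  push Not at hsub
  obtain ⟨j, hji⟩ := hsub
  obtain ⟨a, ha⟩ := h₁.exists_zpow_conj hi₁ (h₁.isConj_of hab₁ j)
  set v := (FreeGroup.of i ^ a)⁻¹ with hv
  apply hconj v
  have h₂ := h₁.conj_comp v
  have hab₂ := hab₁.conj_comp v
  have hi₂ : (MulAut.conj v).toMonoidHom.comp Ψ₁ (FreeGroup.of i) = FreeGroup.of i := by
    change v * Ψ₁ (FreeGroup.of i) * v⁻¹ = _
    rw [hi₁, hv]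
    group
  have hj₂ : (MulAut.conj v).toMonoidHom.comp Ψ₁ (FreeGroup.of j) = FreeGroup.of j := by
    change v * Ψ₁ (FreeGroup.of j) * v⁻¹ = _
    rw [ha, hv]
    group
  generalize (MulAut.conj v).toMonoidHom.comp Ψ₁ = Ψ₂ at h₂ hab₂ hi₂ hj₂ ⊢
  refine hfix fun k => ?_
  rcases eq_or_ne k i with rfl | hki
  · exact hi₂
  rcases eq_or_ne k j with rfl | hkj
  · exact hj₂
  obtain ⟨b, hb⟩ := h₂.exists_zpow_conj hi₂ (h₂.isConj_of hab₂ k)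
  rcases eq_or_ne b 0 with rfl | hb0
  · simpa using hb
  exfalso
  refine h₂ [(j, 1), (k, 1)] (j, 1) [(i, b), (k, 1), (i, -b)] (by simp) ⟨?_, ?_⟩ ?_
  · simp [hb0]
  · simp [hji, hki, hki.symm, hji.symm]
  · refine isConj_iff.2 ⟨1, ?_⟩
    simp [hj₂, hb, mul_assoc]

end SyllableLength

theorem FreeGroup.abelianization_pow_eq_one {ι : Type*} {k : ℕ} (hk : 1 ≤ k)
    {a : Abelianization (FreeGroup ι)} (ha : a ^ k = 1) : a = 1 := by
  have key : ∀ b : FreeAbelianGroup ι, k • b = 0 → b = 0 := by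
    intro b hb
    have h : k • FreeAbelianGroup.equivFinsupp ι b = 0 := by rw [← map_nsmul, hb, map_zero]
    rw [smul_eq_zero] at h
    exact (map_eq_zero_iff _ (FreeAbelianGroup.equivFinsupp ι).injective).1
      (h.resolve_left (by omega))
  exact key (Additive.ofMul a) ha

/-- A unipotent endomorphism of finite order of a torsion-free abelian group is trivial. -/
theorem eq_id_of_unipotent_of_iterate_eq {A : Type*} [CommGroup A]
    {k : ℕ} (htf : ∀ a : A, a ^ k = 1 → a = 1) (T : A →* A) (hT : ∀ a, T^[k] a = a) {m : ℕ}
    (hm : ∀ a, (fun b => T b * b⁻¹)^[m] a = 1) (a : A) : T a = a := by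
  set d : A → A := fun b => T b * b⁻¹
  have key : ∀ m, (∀ a, d^[m + 1] a = 1) → ∀ a, d a = 1 := by
    intro m
    induction m with
    | zero => exact id
    | succ m ih =>
      refine fun hm => ih fun a => ?_
      have hTd : T (d (d^[m] a)) = d (d^[m] a) := by
        have := hm a
        rwa [Function.iterate_succ_apply', Function.iterate_succ_apply', mul_inv_eq_one] at this
      have hTb : T (d^[m] a) = d^[m] a * d (d^[m] a) := by
        simp only [d]
        rw [mul_comm, inv_mul_cancel_right]
      rw [Function.iterate_succ_apply']
      generalize d^[m] a = b at hTd hTb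
      have hpow : ∀ j : ℕ, T^[j] b = b * d b ^ j := by
        intro j
        induction j with
        | zero => simp
        | succ j ihj =>
          rw [Function.iterate_succ_apply', ihj, map_mul, map_pow, hTd, hTb, pow_succ', mul_assoc]
      have := hpow k
      rw [hT, left_eq_mul] at this
      exact htf _ this
  cases m with
  | zero => rw [show a = 1 from hm a, map_one]
  | succ m => exact mul_inv_eq_one.1 (key m hm a)

/-- Lemma `finite order` of the paper: a finite-order outer automorphism of a
finite-rank free group that is unipotent on `H₁(F; ℤ)` is trivial, i.e. inner. -/
theorem finite_order_unipotent_outer_is_inner {n : ℕ} (hn : 1 ≤ n)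
    (Φ : FreeGroup (Fin n) ≃* FreeGroup (Fin n))
    (hfin : ∃ k : ℕ, 1 ≤ k ∧ ∃ g : FreeGroup (Fin n),
      ∀ x : FreeGroup (Fin n), (Φ ^ k) x = g * x * g⁻¹)
    (hunip : ∃ m : ℕ, 1 ≤ m ∧ ∀ a : Abelianization (FreeGroup (Fin n)),
      (fun b : Abelianization (FreeGroup (Fin n)) =>
        Abelianization.map Φ.toMonoidHom b * b⁻¹)^[m] a = 1) :
    ∃ h : FreeGroup (Fin n), ∀ x : FreeGroup (Fin n), Φ x = h * x * h⁻¹ := by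
  obtain ⟨k, hk, g, hg⟩ := hfin
  obtain ⟨m, -, hm⟩ := hunip
  have hiter : ∀ j x, (Φ ^ j) x = Φ.toMonoidHom^[j] x := by
    intro j
    induction j with
    | zero => intro x; rfl
    | succ j ih =>
      intro x
      rw [pow_succ, MulAut.mul_apply, ih]
      rfl
  have hT : ∀ j x, (Abelianization.map Φ.toMonoidHom)^[j] (Abelianization.of x)
      = Abelianization.of (Φ.toMonoidHom^[j] x) := by
    intro j
    induction j with
    | zero => intro x; rfl
    | succ j ih =>
      intro x
      rw [Function.iterate_succ_apply, Abelianization.map_of, ih, Function.iterate_succ_apply]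
  have hab : ActsTriviallyOnAb Φ.toMonoidHom := by
    intro x
    rw [← Abelianization.map_of]
    refine eq_id_of_unipotent_of_iterate_eq
      (fun _ => FreeGroup.abelianization_pow_eq_one hk) _ (fun a => ?_) hm _
    obtain ⟨y, rfl⟩ := QuotientGroup.mk_surjective a
    change (Abelianization.map Φ.toMonoidHom)^[k] (Abelianization.of y) = Abelianization.of y
    rw [hT, ← hiter, hg]
    simp
  exact (hab.nonLengthening hk fun x => (hiter k x).symm.trans (hg x)).eq_inner hab
end

section
/- Let n ≥ 1, F := FreeGroup (Fin n), and Ψ : F ≃* F an automorphism. Let Fix(Ψ) denote the fixed subgroup {x ∈ F | Ψ x = x}. If Fix(Ψ) is nontrivial, then Fix(Ψ) is its own normalizer in F: Subgroup.normalizer (Fix Ψ) = Fix Ψ. (Fact 'FactItsOwnNormalizer' of the paper; nontriviality of Fix(Ψ) is needed to exclude the degenerate case Fix(Ψ) = 1, whose normalizer is all of F.) -/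
/-- The fixed subgroup of an automorphism `Ψ` of a group `G`:
`{x ∈ G | Ψ x = x}`. -/
def fixSubgroup {G : Type*} [Group G] (Ψ : G ≃* G) : Subgroup G where
  carrier := {x : G | Ψ x = x}
  one_mem' := map_one Ψ
  mul_mem' := by
    intro a b ha hb
    simp only [Set.mem_setOf_eq] at *
    rw [map_mul, ha, hb]
  inv_mem' := by
    intro a ha
    simp only [Set.mem_setOf_eq] at *
    rw [map_inv, ha]

namespace FreeGroup

theorem of_commute_of_iff {α : Type*} {a b : α} : Commute (of a) (of b) ↔ a = b := by
  classical
  refine ⟨fun h => ?_, fun h => h ▸ Commute.refl _⟩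
  by_contra hab
  have h' := h.map (lift fun c => if c = a then Equiv.swap (0 : Fin 3) 1 else Equiv.swap 1 2)
  rw [lift_apply_of, lift_apply_of, if_pos rfl, if_neg (Ne.symm hab)] at h'
  exact absurd h'.eq (by decide)

end FreeGroup

namespace IsFreeGroup

variable {G : Type*} [Group G] [IsFreeGroup G]

theorem isMulTorsionFree : IsMulTorsionFree G :=
  (toFreeGroup G).injective.isMulTorsionFree (toFreeGroup G).toMonoidHom

theorem isCyclic_of_commute (h : ∀ a b : G, Commute a b) : IsCyclic G := by
  have : Subsingleton (Generators G) := ⟨fun a b => FreeGroup.of_commute_of_iff.1 <| by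
    simpa using (h ((toFreeGroup G).symm (.of a)) ((toFreeGroup G).symm (.of b))).map
      (toFreeGroup G)⟩
  rcases isEmpty_or_nonempty (Generators G) with hE | ⟨⟨a⟩⟩
  · have : Subsingleton G := (toFreeGroup G).toEquiv.subsingleton
    infer_instance
  · have : Unique (Generators G) := uniqueOfSubsingleton a
    exact isCyclic_of_surjective (toFreeGroup G).symm (toFreeGroup G).symm.surjective

theorem exists_eq_zpowers (H : Subgroup G) (h : ∀ a ∈ H, ∀ b ∈ H, Commute a b) :
    ∃ y, H = Subgroup.zpowers y := by
  have := isCyclic_of_commute (G := H) fun a b => Subtype.ext (h a a.2 b b.2)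
  obtain ⟨y, hy⟩ := H.isCyclic_iff_exists_zpowers_eq_top.1 this
  exact ⟨y, hy.symm⟩

/-- Commuting elements of a free group are powers of a common element. -/
theorem exists_zpow_of_commute {a b : G} (h : Commute a b) :
    ∃ y : G, ∃ i j : ℤ, y ^ i = a ∧ y ^ j = b := by
  have hc := Subgroup.isMulCommutative_closure (k := {a, b}) (by
    rintro x (rfl | rfl) y (rfl | rfl)
    exacts [rfl, h.eq, h.eq.symm, rfl])
  obtain ⟨y, hy⟩ := exists_eq_zpowers (Subgroup.closure {a, b}) fun x hx z hz =>
    setLike_mul_comm hx hz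
  obtain ⟨i, hi⟩ : a ∈ Subgroup.zpowers y := hy ▸ Subgroup.subset_closure (by simp)
  obtain ⟨j, hj⟩ : b ∈ Subgroup.zpowers y := hy ▸ Subgroup.subset_closure (by simp)
  exact ⟨y, i, j, hi, hj⟩

theorem commute_of_zpow_left {a b : G} {k : ℤ} (hk : k ≠ 0) (h : Commute (a ^ k) b) :
    Commute a b := by
  have := isMulTorsionFree (G := G)
  have h1 : b * a * b⁻¹ = a := by
    rw [← zpow_left_inj hk, conj_zpow, ← h.eq, mul_inv_cancel_right]
  exact (mul_inv_eq_iff_eq_mul.1 h1).symm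

/-- Commutation is transitive on the nontrivial elements of a free group. -/
theorem commute_trans {a b c : G} (hc : c ≠ 1) (hac : Commute a c) (hcb : Commute c b) :
    Commute a b := by
  obtain ⟨u, i, j, rfl, rfl⟩ := exists_zpow_of_commute hac
  have hj : j ≠ 0 := by rintro rfl; exact hc (zpow_zero u)
  exact (commute_of_zpow_left hj hcb).zpow_left i

theorem exists_centralizer_eq_zpowers {x : G} (hx : x ≠ 1) :
    ∃ y, ∀ z, Commute z x ↔ z ∈ Subgroup.zpowers y := by
  have key (z : G) : z ∈ Subgroup.centralizer {x} ↔ Commute z x := by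
    rw [Subgroup.mem_centralizer_singleton_iff]; rfl
  obtain ⟨y, hy⟩ := exists_eq_zpowers (Subgroup.centralizer {x}) fun a ha b hb =>
    commute_trans hx ((key a).1 ha) ((key b).1 hb).symm
  exact ⟨y, fun z => by rw [← key, hy]⟩

/-- An element of a free group that commutes with one of its nontrivial conjugates
commutes with the conjugating element. -/
theorem commute_of_commute_conj {g x : G} (hx : x ≠ 1) (h : Commute x (g * x * g⁻¹)) :
    Commute g x := by
  have := isMulTorsionFree (G := G)
  obtain ⟨y, hy⟩ := exists_centralizer_eq_zpowers hx
  obtain ⟨m, hm⟩ := (hy x).1 (Commute.refl x)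
  have hyx : Commute y x := (hy y).2 (Subgroup.mem_zpowers y)
  have hy1 : y ≠ 1 := by
    rintro rfl
    exact hx (by simpa using hm.symm)
  have h' : Commute (g⁻¹ * x * g) x := by
    simpa [mul_assoc] using h.map (MulAut.conj g⁻¹)
  obtain ⟨k, hk⟩ := (hy (g * y * g⁻¹)).1 <|
    commute_trans (c := g * x * g⁻¹) (by simpa using hx) (hyx.map (MulAut.conj g)) h.symm
  obtain ⟨l, hl⟩ := (hy (g⁻¹ * y * g)).1 <|
    commute_trans (c := g⁻¹ * x * g) (by simpa [mul_eq_one_iff_eq_inv] using hx)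
      (by simpa using hyx.map (MulAut.conj g⁻¹)) h'
  simp only at hk hl
  have hkl : y ^ (k * l - 1) = 1 := by
    rw [zpow_sub_one, zpow_mul, hk, conj_zpow, hl]
    group
  rw [IsMulTorsionFree.zpow_eq_one_iff_right hy1, sub_eq_zero] at hkl
  have hgy : Commute g y := by
    rcases Int.eq_one_or_neg_one_of_mul_eq_one hkl with rfl | rfl
    · rw [zpow_one] at hk
      exact eq_mul_inv_iff_mul_eq.1 hk |>.symm
    · rw [zpow_neg_one] at hk
      refine commute_of_zpow_left two_ne_zero (k := 2) ?_
      have h2 : g ^ (2 : ℤ) * y * (g ^ (2 : ℤ))⁻¹ = y := by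
        calc g ^ (2 : ℤ) * y * (g ^ (2 : ℤ))⁻¹ = g * (g * y * g⁻¹) * g⁻¹ := by
              rw [zpow_two]; simp only [mul_inv_rev, mul_assoc]
          _ = (g * y * g⁻¹)⁻¹ := by rw [conj_inv, ← hk]
          _ = y := by rw [← hk, inv_inv]
      exact mul_inv_eq_iff_eq_mul.1 h2
  exact hm ▸ hgy.zpow_right m

end IsFreeGroup

theorem mem_fixSubgroup {G : Type*} [Group G] {Ψ : G ≃* G} {x : G} :
    x ∈ fixSubgroup Ψ ↔ Ψ x = x := Iff.rfl

/-- An element of a free group commuting with a nontrivial fixed point is fixed. -/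
theorem mem_fixSubgroup_of_commute {G : Type*} [Group G] [IsFreeGroup G] {Ψ : G ≃* G} {g x : G}
    (hx : x ∈ fixSubgroup Ψ) (hx1 : x ≠ 1) (h : Commute g x) : g ∈ fixSubgroup Ψ := by
  have := IsFreeGroup.isMulTorsionFree (G := G)
  obtain ⟨y, i, j, rfl, rfl⟩ := IsFreeGroup.exists_zpow_of_commute h
  have hj : j ≠ 0 := by rintro rfl; exact hx1 (zpow_zero y)
  rw [mem_fixSubgroup, map_zpow, zpow_left_inj hj] at hx
  rw [mem_fixSubgroup, map_zpow, hx]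

/-- Fact `FactItsOwnNormalizer` of the paper: a nontrivial fixed subgroup of an
automorphism of a finite-rank free group is its own normalizer. -/
theorem fixSubgroup_self_normalizing {n : ℕ} (hn : 1 ≤ n)
    (Ψ : FreeGroup (Fin n) ≃* FreeGroup (Fin n))
    (hnontriv : fixSubgroup Ψ ≠ ⊥) :
    Subgroup.normalizer (fixSubgroup Ψ) = fixSubgroup Ψ := by
  refine le_antisymm (fun g hg => ?_) Subgroup.le_normalizer
  obtain ⟨x, hx, hx1⟩ := (fixSubgroup Ψ).bot_or_exists_ne_one.resolve_left hnontriv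
  have hgx := (Subgroup.mem_normalizer_iff.1 hg x).1 hx
  have hcomm {z} (hz : z ∈ fixSubgroup Ψ) : Commute (g⁻¹ * Ψ g) z := by
    have h := mem_fixSubgroup.1 ((Subgroup.mem_normalizer_iff.1 hg z).1 hz)
    rw [map_mul, map_mul, map_inv, mem_fixSubgroup.1 hz, mul_inv_eq_iff_eq_mul] at h
    rw [Commute, SemiconjBy, mul_assoc, h]
    group
  by_cases hc : g⁻¹ * Ψ g = 1
  · exact (inv_mul_eq_one.1 hc).symm
  · exact mem_fixSubgroup_of_commute hx hx1 <| IsFreeGroup.commute_of_commute_conj hx1 <|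
      IsFreeGroup.commute_trans hc (hcomm hx).symm (hcomm hgx)
end

section
/- Let F := FreeGroup ι be a free group, let Ψ : F ≃* F be an automorphism, let m ≥ 1, and set A := Fix(Ψ^m) = {x ∈ F | Ψ^m x = x}. Suppose there exists c ∈ A such that Ψ(x) = c * x * c⁻¹ for every x ∈ A (the restriction of Ψ to A is conjugation by an element of A). Then Ψ(x) = x for every x ∈ A; equivalently Fix(Ψ) = Fix(Ψ^m). (This is the group-theoretic content of item (1) of Lemma 'Theta' in the paper: using that subgroups of free groups are free, that nonabelian free groups have trivial center, and that free groups are torsion-free, one deduces c = 1.) -/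
/-- If an automorphism `Ψ` agrees with conjugation by `c` on a subgroup containing `c`, then
`Ψ ^ n` agrees there with conjugation by `c ^ n`. -/
theorem MulEquiv.pow_apply_eq_conj {G : Type*} [Group G] {Ψ : G ≃* G} {A : Subgroup G} {c : G}
    (hc : c ∈ A) (h : ∀ x ∈ A, Ψ x = c * x * c⁻¹) (n : ℕ) {x : G} (hx : x ∈ A) :
    (Ψ ^ n) x = c ^ n * x * (c ^ n)⁻¹ := by
  induction n generalizing x with
  | zero => simp
  | succ n ih =>
    rw [pow_succ, MulAut.mul_apply, h x hx,
      ih (A.mul_mem (A.mul_mem hc hx) (A.inv_mem hc)), pow_succ]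
    group

/-- In a group with unique roots, an element commuting with a nontrivial power of `c`
commutes with `c`. -/
theorem Commute.of_pow_left {G : Type*} [Group G] [IsMulTorsionFree G] {c x : G} {n : ℕ}
    (hn : n ≠ 0) (h : Commute (c ^ n) x) : Commute c x := by
  have hpow : (x * c * x⁻¹) ^ n = c ^ n := by
    rw [conj_pow, ← h.eq, mul_inv_cancel_right]
  exact (mul_inv_eq_iff_eq_mul.mp (pow_left_injective hn hpow)).symm

/-- Item (1) of Lemma `Theta` of the paper: if `Ψ` restricted to
`A = Fix(Ψ^m)` is conjugation by an element `c ∈ A`, then `Ψ` fixes every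
element of `A`; equivalently `Fix(Ψ) = Fix(Ψ^m)`. -/
theorem fix_of_power_eq_fix {ι : Type*}
    (Ψ : FreeGroup ι ≃* FreeGroup ι) (m : ℕ) (hm : 1 ≤ m)
    (hconj : ∃ c ∈ fixSubgroup (Ψ ^ m),
      ∀ x ∈ fixSubgroup (Ψ ^ m), Ψ x = c * x * c⁻¹) :
    ∀ x ∈ fixSubgroup (Ψ ^ m), Ψ x = x := by
  obtain ⟨c, hc, h⟩ := hconj
  intro x hx
  have hfix : c ^ m * x * (c ^ m)⁻¹ = x :=
    (MulEquiv.pow_apply_eq_conj hc h m hx).symm.trans hx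
  have hcomm : Commute c x :=
    Commute.of_pow_left (Nat.one_le_iff_ne_zero.mp hm) (mul_inv_eq_iff_eq_mul.mp hfix)
  rw [h x hx, hcomm.eq, mul_inv_cancel_right]
end

section
/- Let F := FreeGroup ι be a free group and let A ≤ F be a finitely generated subgroup. Then for every c ∈ F there exists a finite subset s of A such that every a ∈ A that is conjugate to c in F is conjugate, by an element of A, to some element of s. (Each F-conjugacy class is represented by only finitely many A-conjugacy classes of elements of A; this claim is established in the proof of Lemma 'LemmaInvariantGroups' via Stallings graphs: A is realized by an immersion of a finite graph, which has only finitely many circuits of a given length.) -/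
theorem List.IsPrefix.of_append {α : Type*} {p l₁ l₂ : List α} (h : p <+: l₁ ++ l₂) :
    p <+: l₁ ∨ ∃ r, p = l₁ ++ r ∧ r <+: l₂ := by
  rcases List.prefix_or_prefix_of_prefix h (List.prefix_append l₁ l₂) with hp | ⟨r, rfl⟩
  · exact Or.inl hp
  · exact Or.inr ⟨r, rfl, (List.prefix_append_right_inj l₁).mp h⟩

namespace FreeGroup

variable {ι : Type*}

/-- Reducing a word creates no new vertices: every prefix of a reduction represents the same
group element as some prefix of the original word. -/
theorem Red.exists_prefix {L₁ L₂ : List (ι × Bool)} (h : Red L₁ L₂) {p : List (ι × Bool)}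
    (hp : p <+: L₂) : ∃ q, q <+: L₁ ∧ mk q = mk p := by
  induction h generalizing p with
  | refl => exact ⟨p, hp, rfl⟩
  | @tail L _ _ hstep ih =>
    obtain ⟨q, hq, hqp⟩ : ∃ q, q <+: L ∧ mk q = mk p := by
      cases hstep with
      | @not L₃ L₄ x b =>
        rcases List.IsPrefix.of_append hp with hp | ⟨r, rfl, hr⟩
        · exact ⟨p, hp.trans (List.prefix_append _ _), rfl⟩
        · refine ⟨L₃ ++ (x, b) :: (x, !b) :: r, ?_, Quot.sound Red.Step.not⟩
          simpa [List.prefix_append_right_inj] using hr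
    obtain ⟨q', hq', h'⟩ := ih hq
    exact ⟨q', hq', h'.trans hqp⟩

theorem norm_pow_le [DecidableEq ι] (x : FreeGroup ι) (n : ℕ) : (x ^ n).norm ≤ n * x.norm := by
  induction n with
  | zero => simp
  | succ n ih =>
    rw [pow_succ, Nat.succ_mul]
    exact (norm_mul_le _ _).trans (Nat.add_le_add_right ih _)

/-- A cyclically reduced word is a shortest representative of its conjugacy class. -/
theorem IsCyclicallyReduced.length_le_norm [DecidableEq ι] {w : List (ι × Bool)}
    (hw : IsCyclicallyReduced w) {c : FreeGroup ι} (h : IsConj c (mk w)) :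
    w.length ≤ c.norm := by
  obtain ⟨g, hg⟩ := isConj_iff.mp h
  by_contra! hlt
  have hpow (n : ℕ) : (mk w ^ n).norm = n * w.length := by
    rw [pow_mk, norm, toWord_mk, (hw.flatten_replicate n).isReduced.reduce_eq]
    simp
  have hbound (n : ℕ) : n * w.length ≤ 2 * g.norm + n * c.norm := by
    rw [← hpow, ← hg, conj_pow]
    have h₁ := norm_mul_le (g * c ^ n) g⁻¹
    have h₂ := norm_mul_le g (c ^ n)
    have h₃ := norm_pow_le c n
    rw [norm_inv_eq] at h₁
    omega
  have := hbound (2 * g.norm + 1)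
  have := Nat.mul_le_mul_left (2 * g.norm + 1) (Nat.succ_le_of_lt hlt)
  rw [Nat.mul_succ] at this
  omega

/-- The letters in elements of the subgroup generated by `S` are, up to sign, letters
of elements of `S`. -/
theorem exists_mem_toWord_of_mem_closure [DecidableEq ι] {S : Set (FreeGroup ι)}
    {a : FreeGroup ι} (ha : a ∈ Subgroup.closure S) :
    ∀ x ∈ a.toWord, ∃ s ∈ S, ∃ y ∈ s.toWord, y.1 = x.1 := by
  induction ha using Subgroup.closure_induction with
  | mem s hs => exact fun x hx => ⟨s, hs, x, hx, rfl⟩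
  | one => simp
  | mul a b _ _ iha ihb =>
    intro x hx
    rcases List.mem_append.mp ((toWord_mul_sublist a b).subset hx) with h | h
    exacts [iha x h, ihb x h]
  | inv a _ iha =>
    intro x hx
    rw [toWord_inv, invRev, List.mem_reverse, List.mem_map] at hx
    obtain ⟨y, hy, rfl⟩ := hx
    exact iha y hy

/-- In the Schreier graph of the subgroup generated by `S`, a reduced loop at the base point
only visits vertices on the loops given by the elements of `S`. -/
theorem exists_mk_prefix_eq_mul_of_mem_closure [DecidableEq ι] {S : Set (FreeGroup ι)}
    {a : FreeGroup ι} (ha : a ∈ Subgroup.closure S) {p : List (ι × Bool)} (hp : p <+: a.toWord) :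
    ∃ b ∈ Subgroup.closure S, ∃ s ∈ insert 1 S, ∃ q, q <+: s.toWord ∧ mk p = b * mk q := by
  induction ha using Subgroup.closure_induction generalizing p with
  | mem s hs => exact ⟨1, one_mem _, s, Or.inr hs, p, hp, (one_mul _).symm⟩
  | one => exact ⟨1, one_mem _, 1, Or.inl rfl, p, hp, (one_mul _).symm⟩
  | mul a b ha hb iha ihb =>
    rw [toWord_mul] at hp
    obtain ⟨q, hq, hqp⟩ := reduce.red.exists_prefix hp
    rw [← hqp]
    rcases List.IsPrefix.of_append hq with hq | ⟨r, rfl, hr⟩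
    · exact iha hq
    · obtain ⟨d, hd, s, hs, t, ht, h⟩ := ihb hr
      refine ⟨a * d, mul_mem ha hd, s, hs, t, ht, ?_⟩
      rw [← mul_mk, mk_toWord, h, mul_assoc]
  | inv a ha iha =>
    obtain ⟨q, hq⟩ := hp
    rw [toWord_inv] at hq
    have hq' : invRev q <+: a.toWord := by
      rw [← invRev_invRev (L₁ := a.toWord), ← hq, invRev_append]
      exact List.prefix_append _ _
    obtain ⟨d, hd, s, hs, t, ht, h⟩ := iha hq'
    refine ⟨a⁻¹ * d, mul_mem (inv_mem ha) hd, s, hs, t, ht, ?_⟩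
    have hmk : mk p * mk q = a⁻¹ := by
      rw [mul_mk, hq, ← inv_mk, mk_toWord]
    rw [mul_assoc, ← h, ← inv_mk, ← hmk, mul_inv_cancel_right]

end FreeGroup

theorem Set.Finite.setOf_list_length_le {α : Type*} {T : Set α} (hT : T.Finite) (n : ℕ) :
    {l : List α | (∀ x ∈ l, x ∈ T) ∧ l.length ≤ n}.Finite := by
  have := hT.to_subtype
  refine ((List.finite_length_le T n).image (List.map Subtype.val)).subset ?_
  rintro l ⟨hl, hn⟩
  lift l to List T using hl
  exact ⟨l, by simpa using hn, rfl⟩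

open FreeGroup in
/-- Each `F`-conjugacy class meets a finitely generated subgroup `A` of a free
group in only finitely many `A`-conjugacy classes (established in the proof of
Lemma `LemmaInvariantGroups` via Stallings graphs). -/
theorem finitely_many_subgroup_conjClasses_in_conjClass {ι : Type*}
    (A : Subgroup (FreeGroup ι)) (hA : Subgroup.FG A) :
    ∀ c : FreeGroup ι, ∃ s : Finset (FreeGroup ι),
      (∀ x ∈ s, x ∈ A) ∧
      ∀ a ∈ A, IsConj a c → ∃ b ∈ s, ∃ g ∈ A, g * a * g⁻¹ = b := by
  classical
  intro c
  obtain ⟨S, rfl⟩ := hA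
  let K : Set (List (ι × Bool)) := ⋃ s ∈ insert 1 (S : Set (FreeGroup ι)), {q | q <+: s.toWord}
  have hK : K.Finite := by
    refine (S.finite_toSet.insert 1).biUnion fun s _ => ?_
    refine (List.finite_toSet s.toWord.inits).subset fun q hq => ?_
    simpa using hq
  let T : Set (ι × Bool) := {x | ∃ s ∈ S, ∃ y ∈ s.toWord, y.1 = x.1}
  have hT : T.Finite := by
    have hfin : (⋃ s ∈ S, {y | y ∈ s.toWord}).Finite :=
      S.finite_toSet.biUnion fun s _ => List.finite_toSet s.toWord
    refine ((hfin.image Prod.fst).prod Set.finite_univ).subset ?_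
    rintro x ⟨s, hs, y, hy, hyx⟩
    exact ⟨⟨y, Set.mem_biUnion hs hy, hyx⟩, trivial⟩
  have hfin := ((hK.prod (hT.setOf_list_length_le c.norm)).image
    fun kw => mk kw.1 * mk kw.2 * (mk kw.1)⁻¹).inter_of_left
      (Subgroup.closure (S : Set (FreeGroup ι)) : Set (FreeGroup ι))
  refine ⟨hfin.toFinset, fun x hx => (hfin.mem_toFinset.mp hx).2, fun a ha hac => ?_⟩
  set v := reduceCyclically.conjugator a.toWord
  set w := reduceCyclically a.toWord
  have hvw : v ++ w ++ invRev v = a.toWord :=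
    reduceCyclically.conj_conjugator_reduceCyclically a.toWord
  have haw : a = mk v * mk w * (mk v)⁻¹ := by
    rw [inv_mk, mul_mk, mul_mk, hvw, mk_toWord]
  have hv : v <+: a.toWord := ⟨w ++ invRev v, by rw [← hvw, List.append_assoc]⟩
  obtain ⟨b, hb, s, hs, q, hq, hbq⟩ := exists_mk_prefix_eq_mul_of_mem_closure ha hv
  have hwlen : w.length ≤ c.norm :=
    (reduceCyclically.isCyclicallyReduced isReduced_toWord).length_le_norm
      (hac.symm.trans (isConj_iff.mpr ⟨mk v, haw.symm⟩).symm)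
  have hwT : ∀ x ∈ w, x ∈ T := fun x hx =>
    exists_mem_toWord_of_mem_closure ha x (by simp [← hvw, hx])
  have hconj : b⁻¹ * a * b⁻¹⁻¹ = mk q * mk w * (mk q)⁻¹ := by
    rw [haw, hbq]; group
  refine ⟨_, hfin.mem_toFinset.mpr ⟨⟨(q, w), ⟨Set.mem_biUnion hs hq, hwT, hwlen⟩, rfl⟩, ?_⟩,
    b⁻¹, inv_mem hb, hconj⟩
  change mk q * mk w * (mk q)⁻¹ ∈ _
  rw [← hconj]
  exact mul_mem (mul_mem (inv_mem hb) ha) (inv_mem (inv_mem hb))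
end

section
/- Let n ≥ 2, let F := FreeGroup (Fin n), and let S be a finite set of conjugacy classes of F (a finite subset of ConjClasses F). Then there exists an automorphism Φ : F ≃* F such that for every i : Fin n the conjugacy class of Φ(FreeGroup.of i) does not belong to S. Equivalently, F has a free basis none of whose elements has conjugacy class in S. (This claim is asserted and used in the proof of Lemma 'LemmaInvariantGroups': since the rank is at least 2, one may choose a free basis whose elements' conjugacy classes miss any given finite set.) -/
namespace FreeGroup

/-- The endomorphism `x i ↦ x i * x j ^ k i` of a free group. -/
def transvectionHom {ι : Type*} (j : ι) (k : ι → ℤ) : FreeGroup ι →* FreeGroup ι :=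
  lift fun i => of i * of j ^ k i

@[simp]
theorem transvectionHom_of {ι : Type*} (j : ι) (k : ι → ℤ) (i : ι) :
    transvectionHom j k (of i) = of i * of j ^ k i := by
  simp [transvectionHom]

theorem transvectionHom_comp_neg {ι : Type*} (j : ι) (k : ι → ℤ) (hk : k j = 0) :
    (transvectionHom j (-k)).comp (transvectionHom j k) = MonoidHom.id _ := by
  ext i
  simp [hk]

/-- The automorphism `x i ↦ x i * x j ^ k i` of a free group, where `k j = 0`. -/
def transvection {ι : Type*} (j : ι) (k : ι → ℤ) (hk : k j = 0) :
    FreeGroup ι ≃* FreeGroup ι :=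
  MonoidHom.toMulEquiv (transvectionHom j k) (transvectionHom j (-k))
    (transvectionHom_comp_neg j k hk)
    (by simpa using transvectionHom_comp_neg j (-k) (by simp [hk]))

@[simp]
theorem transvection_of {ι : Type*} (j : ι) (k : ι → ℤ) (hk : k j = 0) (i : ι) :
    transvection j k hk (of i) = of i * of j ^ k i :=
  transvectionHom_of j k i

/-- The exponent sum of the generator `j`, as a homomorphism to `ℤ`. -/
def exponentSum {ι : Type*} [DecidableEq ι] (j : ι) : FreeGroup ι →* Multiplicative ℤ :=
  lift fun i => if i = j then Multiplicative.ofAdd 1 else 1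

theorem exponentSum_of {ι : Type*} [DecidableEq ι] (j i : ι) :
    exponentSum j (of i) = if i = j then Multiplicative.ofAdd 1 else 1 := by
  simp [exponentSum]

/-- A free group of rank at least two has, for each integer `k`, a basis in which every element
has some exponent sum equal to `k`, at a generator independent of `k`. -/
theorem exists_mulEquiv_exponentSum_eq {ι : Type*} [DecidableEq ι] {a b : ι} (hab : a ≠ b)
    (k : ℤ) : ∃ Φ : FreeGroup ι ≃* FreeGroup ι, ∀ i,
      exponentSum (if i = a then b else a) (Φ (of i)) = Multiplicative.ofAdd k := by
  refine ⟨(transvection a (fun i => if i = a then 0 else k) (by simp)).trans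
    (transvection b (fun i => if i = a then k else 0) (by simp [hab.symm])), fun i => ?_⟩
  by_cases hi : i = a
  · subst hi
    simp [exponentSum_of, hab, ← ofAdd_zsmul]
  · simp [exponentSum_of, hi, hab.symm, ← ofAdd_zsmul]

end FreeGroup

/-- For `n ≥ 2`, the free group of rank `n` has a free basis (the image of the
standard basis under an automorphism) none of whose elements has conjugacy class
in a given finite set `S` of conjugacy classes (claim used in the proof of
Lemma `LemmaInvariantGroups`). -/
theorem exists_basis_avoiding_finitely_many_conjClasses {n : ℕ} (hn : 2 ≤ n)
    (S : Finset (ConjClasses (FreeGroup (Fin n)))) :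
    ∃ Φ : FreeGroup (Fin n) ≃* FreeGroup (Fin n),
      ∀ i : Fin n, ConjClasses.mk (Φ (FreeGroup.of i)) ∉ S := by
  obtain ⟨a, b, hab⟩ : ∃ a b : Fin n, a ≠ b := ⟨⟨0, by omega⟩, ⟨1, by omega⟩, by simp⟩
  choose Φ hΦ using FreeGroup.exists_mulEquiv_exponentSum_eq hab
  have hinj (i : Fin n) : Function.Injective fun k => ConjClasses.mk (Φ k (FreeGroup.of i)) := by
    intro k l hkl
    have h := (FreeGroup.exponentSum (if i = a then b else a)).map_isConj
      (ConjClasses.mk_eq_mk_iff_isConj.1 hkl)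
    rw [hΦ, hΦ, isConj_iff_eq] at h
    exact Multiplicative.ofAdd.injective h
  obtain ⟨k, hk⟩ := (Set.finite_iUnion fun i =>
    S.finite_toSet.preimage (hinj i).injOn).exists_notMem
  exact ⟨Φ k, fun i hi => hk (Set.mem_iUnion.2 ⟨i, hi⟩)⟩
end

section
/- Let n ≥ 1, F := FreeGroup (Fin n), and let Φ : F ≃* F act trivially on H₁(F; ℤ/3). If there exist k ≥ 1 and g ∈ F such that Φ^k(x) = g * x * g⁻¹ for all x ∈ F (Φ has finite order as an outer automorphism), then Φ is inner: there exists h ∈ F with Φ(x) = h * x * h⁻¹ for all x ∈ F. (IA_n(ℤ/3) is torsion-free, as asserted in the introduction of the paper: the usual proof that Out(F_n) is virtually torsion free shows this.) -/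
/-- An automorphism `Φ` of the free group acts trivially on `H₁(F; ℤ/3)`:
for every `x` there is `y` in the abelianization with
`Abelianization.of (Φ x) = Abelianization.of x * y ^ 3`. -/
def ActsTriviallyOnH1Mod3 {n : ℕ}
    (Φ : FreeGroup (Fin n) ≃* FreeGroup (Fin n)) : Prop :=
  ∀ x : FreeGroup (Fin n), ∃ y : Abelianization (FreeGroup (Fin n)),
    Abelianization.of (Φ x) = Abelianization.of x * y ^ 3

namespace FoxCalculus

open MonoidAlgebra

section FoxDerivative

/-- The integral group ring. -/
abbrev GroupRing (G : Type*) := MonoidAlgebra ℤ G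

/-- The augmentation of the integral group ring. -/
noncomputable def aug (G : Type*) [Group G] : GroupRing G →ₐ[ℤ] ℤ :=
  MonoidAlgebra.lift ℤ ℤ G 1

@[simp]
lemma aug_of {G : Type*} [Group G] (x : G) : aug G (of ℤ G x) = 1 := by
  simp [aug]

/-- Two additive maps on the group ring agreeing on group elements are equal. -/
lemma addHom_eq_of_of {G A : Type*} [Group G] [AddCommGroup A] {f g : GroupRing G →+ A}
    (h : ∀ x, f (of ℤ G x) = g (of ℤ G x)) (a : GroupRing G) : f a = g a := by
  induction a using MonoidAlgebra.induction_on with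
  | of m => exact h m
  | add x y hx hy => rw [map_add, map_add, hx, hy]
  | smul r x hx => rw [map_zsmul, map_zsmul, hx]

variable {ι : Type*} [DecidableEq ι]

/-- The affine action of the free group on its group ring whose translation part is the
Fox derivative with respect to the generator `i`. -/
noncomputable def foxAffine (i : ι) : FreeGroup ι →* Equiv.Perm (GroupRing (FreeGroup ι)) :=
  FreeGroup.lift fun j ↦
    { toFun := fun a ↦ of ℤ _ (FreeGroup.of j) * a + if i = j then 1 else 0
      invFun := fun a ↦ of ℤ _ (FreeGroup.of j)⁻¹ * (a - if i = j then 1 else 0)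
      left_inv := fun a ↦ by
        beta_reduce
        rw [add_sub_cancel_right, ← mul_assoc, ← map_mul, inv_mul_cancel, map_one, one_mul]
      right_inv := fun a ↦ by
        beta_reduce
        rw [← mul_assoc, ← map_mul, mul_inv_cancel, map_one, one_mul, sub_add_cancel] }

lemma foxAffine_of (i j : ι) (a : GroupRing (FreeGroup ι)) :
    foxAffine i (FreeGroup.of j) a = of ℤ _ (FreeGroup.of j) * a + if i = j then 1 else 0 := by
  simp [foxAffine]

lemma foxAffine_apply (i : ι) (x : FreeGroup ι) (a : GroupRing (FreeGroup ι)) :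
    foxAffine i x a = of ℤ _ x * a + foxAffine i x 0 := by
  induction x using FreeGroup.induction_on generalizing a with
  | C1 => simp [-of_apply]
  | of j => simp only [foxAffine_of, mul_zero, zero_add]
  | inv_of j h =>
    have key (b : GroupRing (FreeGroup ι)) : foxAffine i (FreeGroup.of j)⁻¹ b =
        of ℤ _ (FreeGroup.of j)⁻¹ * (b - if i = j then 1 else 0) := by
      rw [map_inv, Equiv.Perm.inv_eq_iff_eq, foxAffine_of, ← mul_assoc, ← map_mul,
        mul_inv_cancel, map_one, one_mul, sub_add_cancel]
    rw [key, key, mul_sub, zero_sub, mul_neg, sub_eq_add_neg]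
  | mul x y hx hy =>
    rw [map_mul, Equiv.Perm.mul_apply, Equiv.Perm.mul_apply, hy, hx, hx (foxAffine i y 0), map_mul]
    noncomm_ring

/-- The Fox derivative of the group ring of a free group with respect to a generator. -/
noncomputable def fox (i : ι) : GroupRing (FreeGroup ι) →+ GroupRing (FreeGroup ι) :=
  ((MonoidAlgebra.coeffAddEquiv (R := ℤ) (M := FreeGroup ι)).toAddMonoidHom : _ →+ _) |>
    (Finsupp.linearCombination ℤ fun x ↦ foxAffine i x 0).toAddMonoidHom.comp

lemma fox_of (i : ι) (x : FreeGroup ι) : fox i (of ℤ _ x) = foxAffine i x 0 := by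
  simp [fox]

lemma fox_of_of (i j : ι) :
    fox i (of ℤ _ (FreeGroup.of j)) = if i = j then 1 else 0 := by
  rw [fox_of, foxAffine_of, mul_zero, zero_add]

@[simp]
lemma fox_one (i : ι) : fox i 1 = 0 := by
  rw [← map_one (of ℤ _), fox_of, map_one, Equiv.Perm.one_apply]

lemma fox_mul (i : ι) (a b : GroupRing (FreeGroup ι)) :
    fox i (a * b) = aug _ b • fox i a + a * fox i b := by
  induction a using MonoidAlgebra.induction_on with
  | add x y hx hy => simp only [add_mul, map_add, hx, hy, smul_add]; abel
  | smul r x hx => simp only [smul_mul_assoc, map_zsmul, hx, smul_add, smul_comm r]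
  | of x =>
    induction b using MonoidAlgebra.induction_on with
    | add y z hy hz => simp only [mul_add, map_add, hy, hz, add_smul]; abel
    | smul r y hy =>
      simp only [mul_smul_comm, map_zsmul, hy, smul_add, map_smul, smul_eq_mul, mul_smul]
    | of y =>
      rw [← map_mul, fox_of, fox_of, fox_of, map_mul, Equiv.Perm.mul_apply, foxAffine_apply,
        aug_of, one_smul, add_comm]

lemma fox_of_mul (i : ι) (x y : FreeGroup ι) :
    fox i (of ℤ _ (x * y)) = fox i (of ℤ _ x) + of ℤ _ x * fox i (of ℤ _ y) := by
  rw [map_mul, fox_mul, aug_of, one_smul]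

lemma fox_of_inv (i : ι) (x : FreeGroup ι) :
    fox i (of ℤ _ x⁻¹) = - (of ℤ _ x⁻¹ * fox i (of ℤ _ x)) := by
  have h := fox_of_mul i x⁻¹ x
  rw [inv_mul_cancel, map_one, fox_one] at h
  exact eq_neg_of_add_eq_zero_left h.symm

/-- The fundamental formula of Fox calculus. -/
lemma fox_fundamental [Fintype ι] (a : GroupRing (FreeGroup ι)) :
    a = aug _ a • 1 + ∑ i, fox i a * (of ℤ _ (FreeGroup.of i) - 1) := by
  induction a using MonoidAlgebra.induction_on with
  | add x y hx hy =>
    conv_lhs => rw [hx, hy]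
    simp only [map_add, add_mul, Finset.sum_add_distrib, add_smul]
    abel
  | smul r x hx =>
    conv_lhs => rw [hx]
    simp only [map_zsmul, map_smul, smul_add, Finset.smul_sum, smul_mul_assoc, smul_assoc]
  | of x =>
    rw [aug_of, one_smul]
    induction x using FreeGroup.induction_on with
    | C1 => simp [-of_apply]
    | of j =>
      simp only [fox_of_of, ite_mul, one_mul, zero_mul, Finset.sum_ite_eq', Finset.mem_univ, if_true]
      abel
    | inv_of j h =>
      simp only [fox_of_inv, neg_mul, mul_assoc, Finset.sum_neg_distrib, ← Finset.mul_sum]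
      have h' := eq_sub_of_add_eq' h.symm
      rw [h', mul_sub, ← map_mul, inv_mul_cancel, map_one, mul_one]
      abel
    | mul x y hx hy =>
      simp only [fox_of_mul, add_mul, Finset.sum_add_distrib, mul_assoc, ← Finset.mul_sum]
      have hx' := eq_sub_of_add_eq' hx.symm
      have hy' := eq_sub_of_add_eq' hy.symm
      rw [hx', hy', map_mul, mul_sub, mul_one]
      abel

/-- The ring endomorphism of a group ring induced by an automorphism of the group. -/
noncomputable def ringMap {G : Type*} [Group G] (Φ : MulAut G) : GroupRing G →+* GroupRing G :=
  MonoidAlgebra.mapDomainRingHom ℤ (Φ : G →* G)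

@[simp]
lemma ringMap_of {G : Type*} [Group G] (Φ : MulAut G) (x : G) :
    ringMap Φ (of ℤ _ x) = of ℤ _ (Φ x) := by
  simp [ringMap]

@[simp]
lemma aug_ringMap {G : Type*} [Group G] (Φ : MulAut G) (a : GroupRing G) :
    aug G (ringMap Φ a) = aug G a := by
  refine addHom_eq_of_of (f := (aug G).toRingHom.toAddMonoidHom.comp (ringMap Φ).toAddMonoidHom)
    (g := (aug G).toRingHom.toAddMonoidHom) (fun x ↦ ?_) a
  simp [-of_apply]

lemma ringMap_mul {G : Type*} [Group G] (Φ Ψ : MulAut G) (a : GroupRing G) :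
    ringMap (Φ * Ψ) a = ringMap Φ (ringMap Ψ a) := by
  refine addHom_eq_of_of (f := (ringMap (Φ * Ψ)).toAddMonoidHom)
    (g := (ringMap Φ).toAddMonoidHom.comp (ringMap Ψ).toAddMonoidHom) (fun x ↦ ?_) a
  simp [-of_apply]

/-- The chain rule of Fox calculus. -/
lemma fox_ringMap [Fintype ι] (Φ : MulAut (FreeGroup ι)) (i : ι) (a : GroupRing (FreeGroup ι)) :
    fox i (ringMap Φ a) =
      ∑ j, ringMap Φ (fox j a) * fox i (of ℤ _ (Φ (FreeGroup.of j))) := by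
  have h := congrArg (fun b ↦ fox i (ringMap Φ b)) (fox_fundamental a)
  simp only [map_add, map_sum, map_mul, map_sub, map_one, fox_mul, ringMap_of, map_zsmul,
    fox_one, aug_of, sub_self, zero_smul, zero_add, smul_zero, sub_zero] at h
  exact h

end FoxDerivative

section AugmentationPowers

variable {ι : Type*} [DecidableEq ι]

/-- The powers of the augmentation ideal of a free group, described by Fox derivatives. -/
noncomputable def augPow (ι : Type*) [DecidableEq ι] : ℕ → AddSubgroup (GroupRing (FreeGroup ι))
  | 0 => ⊤
  | k + 1 => (aug (FreeGroup ι)).toRingHom.toAddMonoidHom.ker ⊓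
      ⨅ i, (augPow ι k).comap (fox i)

lemma mem_augPow_zero (a : GroupRing (FreeGroup ι)) : a ∈ augPow ι 0 := AddSubgroup.mem_top a

lemma mem_augPow_succ {k : ℕ} {a : GroupRing (FreeGroup ι)} :
    a ∈ augPow ι (k + 1) ↔ aug _ a = 0 ∧ ∀ i, fox i a ∈ augPow ι k := by
  simp [augPow, AddSubgroup.mem_inf, AddSubgroup.mem_iInf, AddMonoidHom.mem_ker]

lemma augPow_succ_le (k : ℕ) : augPow ι (k + 1) ≤ augPow ι k := by
  induction k with
  | zero => exact le_top
  | succ k ih =>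
    intro a ha
    rw [mem_augPow_succ] at ha ⊢
    exact ⟨ha.1, fun i ↦ ih (ha.2 i)⟩

lemma augPow_antitone : Antitone (augPow ι) := antitone_nat_of_succ_le augPow_succ_le

lemma augPow_mul_right {k : ℕ} {a : GroupRing (FreeGroup ι)} (ha : a ∈ augPow ι k)
    (b : GroupRing (FreeGroup ι)) : a * b ∈ augPow ι k := by
  induction k generalizing a b with
  | zero => exact mem_augPow_zero _
  | succ k ih =>
    have ha' := mem_augPow_succ.1 ha
    refine mem_augPow_succ.2 ⟨by rw [map_mul, ha'.1, zero_mul], fun i ↦ ?_⟩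
    rw [fox_mul]
    exact add_mem (zsmul_mem (ha'.2 i) _) (ih (augPow_succ_le k ha) _)

lemma augPow_mul {k l : ℕ} {a b : GroupRing (FreeGroup ι)} (ha : a ∈ augPow ι k)
    (hb : b ∈ augPow ι l) : a * b ∈ augPow ι (k + l) := by
  induction l generalizing b with
  | zero => exact augPow_mul_right ha b
  | succ l ih =>
    have hb' := mem_augPow_succ.1 hb
    refine mem_augPow_succ.2 ⟨by rw [map_mul, hb'.1, mul_zero], fun i ↦ ?_⟩
    rw [fox_mul, hb'.1, zero_smul, zero_add]
    exact ih (hb'.2 i)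

lemma augPow_mul_left {k : ℕ} {b : GroupRing (FreeGroup ι)} (a : GroupRing (FreeGroup ι))
    (hb : b ∈ augPow ι k) : a * b ∈ augPow ι k := by
  simpa using augPow_mul (mem_augPow_zero a) hb

lemma of_sub_one_mem_augPow_one (x : FreeGroup ι) : of ℤ _ x - 1 ∈ augPow ι 1 :=
  mem_augPow_succ.2 ⟨by rw [map_sub, aug_of, map_one, sub_self], fun _ ↦ mem_augPow_zero _⟩

lemma augPow_ringMap [Fintype ι] (Φ : MulAut (FreeGroup ι)) {k : ℕ}
    {a : GroupRing (FreeGroup ι)} (ha : a ∈ augPow ι k) : ringMap Φ a ∈ augPow ι k := by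
  induction k generalizing a with
  | zero => exact mem_augPow_zero _
  | succ k ih =>
    have ha' := mem_augPow_succ.1 ha
    refine mem_augPow_succ.2 ⟨by rw [aug_ringMap, ha'.1], fun i ↦ ?_⟩
    rw [fox_ringMap]
    exact sum_mem fun j _ ↦ augPow_mul_right (ih (ha'.2 j)) _

/-- The quotient by a power of the augmentation ideal is a residually finite abelian group. -/
lemma mem_augPow_of_forall_exists {N : ℤ} (hN : 1 < N) {k : ℕ} {a : GroupRing (FreeGroup ι)}
    (h : ∀ j : ℕ, ∃ b, a - N ^ j • b ∈ augPow ι k) : a ∈ augPow ι k := by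
  induction k generalizing a with
  | zero => exact mem_augPow_zero _
  | succ k ih =>
    refine mem_augPow_succ.2 ⟨?_, fun i ↦ ih fun j ↦ ?_⟩
    · by_contra h0
      obtain ⟨b, hb⟩ := h (aug _ a).natAbs
      have hb' := (mem_augPow_succ.1 hb).1
      rw [map_sub, map_zsmul, smul_eq_mul, sub_eq_zero] at hb'
      have h1 := Int.le_of_dvd (abs_pos.2 h0) ((dvd_abs _ _).2 (Dvd.intro _ hb'.symm))
      have h2 : (aug _ a).natAbs < N.toNat ^ (aug _ a).natAbs :=
        Nat.lt_pow_self (by omega)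
      have h3 : ((N.toNat ^ (aug _ a).natAbs : ℕ) : ℤ) = N ^ (aug _ a).natAbs := by
        rw [Nat.cast_pow, Int.toNat_of_nonneg (by omega)]
      rw [← h3, ← Int.natCast_natAbs, Nat.cast_le] at h1
      omega
    · obtain ⟨b, hb⟩ := h j
      refine ⟨fox i b, ?_⟩
      rw [← map_zsmul, ← map_sub]
      exact (mem_augPow_succ.1 hb).2 i

lemma mem_augPow_of_zsmul_mem {M : ℤ} (hM : M ≠ 0) {k : ℕ} {a : GroupRing (FreeGroup ι)}
    (h : M • a ∈ augPow ι k) : a ∈ augPow ι k := by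
  induction k generalizing a with
  | zero => exact mem_augPow_zero _
  | succ k ih =>
    have h' := mem_augPow_succ.1 h
    refine mem_augPow_succ.2 ⟨?_, fun i ↦ ih ?_⟩
    · simpa [hM] using h'.1
    · rw [← map_zsmul]
      exact h'.2 i

/-- Prepending the letter `i` to words not starting with `i`, on integer valued functions
on words. -/
def prepend (i : ι) : Module.End ℤ (List ι → ℤ) where
  toFun f w := match w with
    | [] => 0
    | j :: w => if i = j ∧ w.head? ≠ some i then f w else 0
  map_add' f g := by
    ext w
    cases w with
    | nil => simp
    | cons j w =>
      by_cases h : i = j ∧ w.head? ≠ some i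
      · simp only [Pi.add_apply, if_pos h]
      · simp only [Pi.add_apply, if_neg h, add_zero]
  map_smul' c f := by
    ext w
    cases w with
    | nil => simp
    | cons j w =>
      by_cases h : i = j ∧ w.head? ≠ some i
      · simp only [Pi.smul_apply, if_pos h, RingHom.id_apply]
      · simp only [Pi.smul_apply, if_neg h, smul_zero]

@[simp]
lemma prepend_nil (i : ι) (f : List ι → ℤ) : prepend i f [] = 0 := rfl

@[simp]
lemma prepend_cons (i j : ι) (f : List ι → ℤ) (w : List ι) :
    prepend i f (j :: w) = if i = j ∧ w.head? ≠ some i then f w else 0 := rfl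

lemma prepend_mul_self (i : ι) : prepend i * prepend i = 0 := by
  ext f w
  rcases w with _ | ⟨j, _ | ⟨l, w⟩⟩
  · simp
  · simp
  · simp only [Module.End.mul_apply, prepend_cons, List.head?_cons, LinearMap.zero_apply,
      Pi.zero_apply]
    by_cases h : i = l <;> simp [h]

/-- The Magnus representation of the free group, modulo squares of the variables. -/
def magnus : FreeGroup ι →* (Module.End ℤ (List ι → ℤ))ˣ :=
  FreeGroup.lift fun i ↦
    { val := 1 + prepend i
      inv := 1 - prepend i
      val_inv := by
        rw [add_mul, mul_sub, mul_sub, prepend_mul_self]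
        simp
      inv_val := by
        rw [sub_mul, mul_add, mul_add, prepend_mul_self]
        simp }

lemma magnus_of (i : ι) :
    (magnus (FreeGroup.of i) : Module.End ℤ (List ι → ℤ)) = 1 + prepend i := by
  simp [magnus]

lemma magnus_of_inv (i : ι) :
    (magnus (FreeGroup.of i)⁻¹ : Module.End ℤ (List ι → ℤ)) = 1 - prepend i := by
  rw [map_inv]
  simp [magnus]

/-- The linear extension of the Magnus representation to the group ring. -/
noncomputable def magnusRing : GroupRing (FreeGroup ι) →ₐ[ℤ] Module.End ℤ (List ι → ℤ) :=
  MonoidAlgebra.lift ℤ _ _ ((Units.coeHom _).comp magnus)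

lemma magnusRing_of (x : FreeGroup ι) : magnusRing (of ℤ _ x) = magnus x := by
  simp [magnusRing]

/-- The functions on words vanishing on words of length less than `k`. -/
def lengthFiltration (ι : Type*) (k : ℕ) : AddSubgroup (List ι → ℤ) where
  carrier := {f | ∀ w : List ι, w.length < k → f w = 0}
  zero_mem' _ _ := rfl
  add_mem' hf hg w hw := by rw [Pi.add_apply, hf w hw, hg w hw, add_zero]
  neg_mem' hf w hw := by rw [Pi.neg_apply, hf w hw, neg_zero]

lemma prepend_mem_lengthFiltration (i : ι) {k : ℕ} {f : List ι → ℤ}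
    (hf : f ∈ lengthFiltration ι k) : prepend i f ∈ lengthFiltration ι (k + 1) := by
  rintro (_ | ⟨j, w⟩) hw
  · rfl
  · rw [prepend_cons, hf w (by simpa using hw), ite_self]

lemma lengthFiltration_succ_le {ι : Type*} (k : ℕ) : lengthFiltration ι (k + 1) ≤ lengthFiltration ι k :=
  fun _ hf w hw ↦ hf w (hw.trans k.lt_succ_self)

lemma magnusRing_mem_lengthFiltration (a : GroupRing (FreeGroup ι)) {l : ℕ} {f : List ι → ℤ}
    (hf : f ∈ lengthFiltration ι l) : magnusRing a f ∈ lengthFiltration ι l := by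
  induction a using MonoidAlgebra.induction_on generalizing f with
  | add x y hx hy =>
    rw [map_add]
    exact add_mem (hx hf) (hy hf)
  | smul r x hx =>
    rw [map_zsmul]
    exact zsmul_mem (hx hf) r
  | of x =>
    rw [magnusRing_of]
    induction x using FreeGroup.induction_on generalizing f with
    | C1 => simpa using hf
    | of i =>
      rw [magnus_of]
      exact add_mem hf (lengthFiltration_succ_le l (prepend_mem_lengthFiltration i hf))
    | inv_of i _ =>
      rw [magnus_of_inv]
      exact sub_mem hf (lengthFiltration_succ_le l (prepend_mem_lengthFiltration i hf))
    | mul x y hx hy =>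
      rw [map_mul]
      exact hx (hy hf)

lemma magnusRing_augPow_mem [Fintype ι] {k l : ℕ} {a : GroupRing (FreeGroup ι)}
    (ha : a ∈ augPow ι k) {f : List ι → ℤ} (hf : f ∈ lengthFiltration ι l) :
    magnusRing a f ∈ lengthFiltration ι (k + l) := by
  induction k generalizing a l f with
  | zero => simpa using magnusRing_mem_lengthFiltration a hf
  | succ k ih =>
    obtain ⟨h0, h1⟩ := mem_augPow_succ.1 ha
    rw [fox_fundamental a, h0, zero_smul, zero_add, map_sum, LinearMap.sum_apply]
    refine sum_mem fun i _ ↦ ?_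
    rw [map_mul, map_sub, magnusRing_of, magnus_of, map_one, add_sub_cancel_left,
      add_right_comm, add_assoc]
    exact ih (h1 i) (prepend_mem_lengthFiltration i hf)

end AugmentationPowers

section ResidualNilpotence

variable {ι : Type*} [DecidableEq ι]

/-- The indicator function of the empty word. -/
def emptyWord (ι : Type*) : List ι → ℤ
  | [] => 1
  | _ :: _ => 0

lemma magnus_mk_cons (i : ι) (s : Bool) (L : List (ι × Bool)) (f : List ι → ℤ) :
    (magnus (FreeGroup.mk ((i, s) :: L)) : Module.End ℤ (List ι → ℤ)) f =
      (magnus (FreeGroup.mk L) : Module.End ℤ (List ι → ℤ)) f + (if s then (1 : ℤ) else -1) •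
        prepend i ((magnus (FreeGroup.mk L) : Module.End ℤ (List ι → ℤ)) f) := by
  have h : FreeGroup.mk ((i, s) :: L) = FreeGroup.mk [(i, s)] * FreeGroup.mk L := by
    rw [FreeGroup.mul_mk, List.singleton_append]
  rw [h, map_mul, Units.val_mul, Module.End.mul_apply]
  cases s with
  | true =>
    have : FreeGroup.mk [(i, true)] = FreeGroup.of i := rfl
    rw [this, magnus_of]
    simp
  | false =>
    have : FreeGroup.mk [(i, false)] = (FreeGroup.of i)⁻¹ := rfl
    rw [this, magnus_of_inv]
    simp [sub_eq_add_neg]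

lemma exists_magnus_mk_of_isReduced (i : ι) (s : Bool) (L : List (ι × Bool))
    (hL : FreeGroup.IsReduced ((i, s) :: L)) :
    ∃ (e : ℤ) (g : List ι → ℤ) (w : List ι), 0 < (if s then (1 : ℤ) else -1) * e ∧
      (magnus (FreeGroup.mk ((i, s) :: L)) : Module.End ℤ (List ι → ℤ)) (emptyWord ι) =
        g + e • prepend i g ∧
      w.head? ≠ some i ∧ g w ≠ 0 ∧ ∀ u : List ι, w.length < u.length → g u = 0 := by
  induction L generalizing i s with
  | nil =>
    refine ⟨if s then 1 else -1, emptyWord ι, [], by cases s <;> simp, ?_, by simp,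
      by simp [emptyWord], ?_⟩
    · rw [magnus_mk_cons, ← FreeGroup.one_eq_mk, map_one]
      simp
    · rintro (_ | ⟨j, u⟩) hu
      · simp at hu
      · rfl
  | cons p L ih =>
    obtain ⟨j, t⟩ := p
    have hL' : FreeGroup.IsReduced ((j, t) :: L) := List.IsChain.tail hL
    obtain ⟨e, g, w, he, hf, hw, hg, hv⟩ := ih j t hL'
    have he0 : e ≠ 0 := by
      rintro rfl
      simp at he
    rw [magnus_mk_cons, hf]
    by_cases hij : i = j
    · subst hij
      have hst : s = t := (List.isChain_cons_cons.1 hL).1 rfl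
      subst hst
      refine ⟨e + if s then 1 else -1, g, w, ?_, ?_, hw, hg, hv⟩
      · cases s <;> simp at he ⊢ <;> omega
      · have h2 : prepend i (prepend i g) = 0 := by
          rw [← Module.End.mul_apply, prepend_mul_self, LinearMap.zero_apply]
        rw [map_add, map_zsmul, h2, smul_zero, add_zero, add_smul, add_assoc]
    · refine ⟨if s then 1 else -1, g + e • prepend j g, j :: w, by cases s <;> simp, rfl, ?_, ?_, ?_⟩
      · simpa using Ne.symm hij
      · rw [Pi.add_apply, Pi.smul_apply, prepend_cons, if_pos ⟨rfl, hw⟩, hv _ (by simp), zero_add,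
          smul_eq_mul]
        exact mul_ne_zero he0 hg
      · rintro (_ | ⟨l, u⟩) hu
        · simp at hu
        · rw [List.length_cons, List.length_cons, Nat.succ_lt_succ_iff] at hu
          rw [Pi.add_apply, Pi.smul_apply, prepend_cons, hv u hu,
            hv (l :: u) (hu.trans (Nat.lt_succ_self _)), ite_self, smul_zero, add_zero]

lemma magnus_emptyWord_ne {x : FreeGroup ι} (hx : x ≠ 1) :
    (magnus x : Module.End ℤ (List ι → ℤ)) (emptyWord ι) ≠ emptyWord ι := by
  intro h
  rw [← FreeGroup.mk_toWord (x := x)] at h hx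
  have hr := FreeGroup.isReduced_toWord (x := x)
  generalize x.toWord = L at h hx hr
  rcases L with _ | ⟨⟨i, s⟩, L⟩
  · exact hx rfl
  · obtain ⟨e, g, w, he, hf, hw, hg, hv⟩ := exists_magnus_mk_of_isReduced i s L hr
    have h1 := congrFun (hf.symm.trans h) (i :: w)
    rw [Pi.add_apply, Pi.smul_apply, prepend_cons, if_pos ⟨rfl, hw⟩, hv _ (by simp), zero_add,
      smul_eq_mul] at h1
    have h2 := mul_eq_zero.1 (h1 : e * g w = 0)
    rcases h2 with rfl | h2
    · simp at he
    · exact hg h2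

/-- Magnus' theorem: a free group is residually nilpotent, in terms of powers of the
augmentation ideal. -/
lemma eq_one_of_forall_mem_augPow [Fintype ι] {x : FreeGroup ι}
    (h : ∀ k, of ℤ _ x - 1 ∈ augPow ι k) : x = 1 := by
  by_contra hx
  refine magnus_emptyWord_ne hx (sub_eq_zero.1 (funext fun w ↦ ?_))
  have h0 : emptyWord ι ∈ lengthFiltration ι 0 := fun w hw ↦ absurd hw (Nat.not_lt_zero _)
  have h1 := magnusRing_augPow_mem (h (w.length + 1)) h0 w (Nat.lt_succ_self _)
  rwa [map_sub, magnusRing_of, map_one] at h1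

lemma eq_of_forall_sub_mem_augPow [Fintype ι] {x y : FreeGroup ι}
    (h : ∀ k, of ℤ _ x - of ℤ _ y ∈ augPow ι k) : x = y := by
  rw [← inv_mul_eq_one]
  refine eq_one_of_forall_mem_augPow fun k ↦ ?_
  have := neg_mem (augPow_mul_left (of ℤ _ x⁻¹) (h k))
  rwa [mul_sub, ← map_mul, ← map_mul, inv_mul_cancel, map_one, neg_sub] at this

/-- An automorphism of finite order acting trivially on the abelianization is trivial. -/
lemma eq_one_of_pow_eq_one_of_aug [Fintype ι] {Φ : MulAut (FreeGroup ι)} {m : ℕ} (hm : m ≠ 0)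
    (hpow : Φ ^ m = 1)
    (hΦ : ∀ i j, aug _ (fox i (of ℤ _ (Φ (FreeGroup.of j)))) = if i = j then 1 else 0) :
    Φ = 1 := by
  have key : ∀ (k : ℕ) (a : GroupRing (FreeGroup ι)), a ∈ augPow ι k →
      ringMap Φ a - a ∈ augPow ι (k + 1) := by
    intro k
    induction k with
    | zero =>
      intro a _
      exact mem_augPow_succ.2 ⟨by rw [map_sub, aug_ringMap, sub_self], fun _ ↦ mem_augPow_zero _⟩
    | succ k ih =>
      intro a ha
      obtain ⟨h0, h1⟩ := mem_augPow_succ.1 ha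
      refine mem_augPow_succ.2 ⟨by rw [map_sub, aug_ringMap, sub_self], fun i ↦ ?_⟩
      have h2 : fox i (ringMap Φ a - a) = (ringMap Φ (fox i a) - fox i a) +
          ∑ j, ringMap Φ (fox j a) *
            (fox i (of ℤ _ (Φ (FreeGroup.of j))) - if i = j then 1 else 0) := by
        simp only [mul_sub, Finset.sum_sub_distrib, map_sub, fox_ringMap, mul_ite, mul_one,
          mul_zero, Finset.sum_ite_eq, Finset.mem_univ, if_true]
        abel
      rw [h2]
      refine add_mem (ih _ (h1 i)) (sum_mem fun j _ ↦ ?_)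
      refine augPow_mul (augPow_ringMap Φ (h1 j)) (mem_augPow_succ.2 ⟨?_, fun _ ↦ mem_augPow_zero _⟩)
      rw [map_sub, hΦ]
      split_ifs <;> simp
  have hpow' (a : GroupRing (FreeGroup ι)) : (ringMap Φ)^[m] a = a := by
    have h (l : ℕ) : (ringMap Φ)^[l] a = ringMap (Φ ^ l) a := by
      induction l with
      | zero =>
        refine addHom_eq_of_of (f := AddMonoidHom.id _)
          (g := (ringMap (1 : MulAut (FreeGroup ι))).toAddMonoidHom) (fun x ↦ ?_) a
        simp [-of_apply]
      | succ l ih => rw [Function.iterate_succ_apply', ih, ← ringMap_mul, pow_succ']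
    rw [h, hpow, ← pow_zero Φ, ← h, Function.iterate_zero_apply]
  have main : ∀ (k : ℕ) (a : GroupRing (FreeGroup ι)), ringMap Φ a - a ∈ augPow ι k := by
    intro k
    induction k with
    | zero => exact fun a ↦ mem_augPow_zero _
    | succ k ih =>
      intro a
      refine mem_augPow_of_zsmul_mem (M := m) (by exact_mod_cast hm) ?_
      have h1 (l : ℕ) : (ringMap Φ)^[l] (ringMap Φ a - a) - (ringMap Φ a - a) ∈
          augPow ι (k + 1) := by
        induction l with
        | zero => simp
        | succ l ihl =>
          have h2 := key k _ (ih a)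
          have h3 := augPow_ringMap Φ ihl
          rw [map_sub] at h3
          rw [Function.iterate_succ_apply']
          have := add_mem h3 h2
          rwa [sub_add_sub_cancel] at this
      have h4 (l : ℕ) : (ringMap Φ)^[l] a - a - (l : ℤ) • (ringMap Φ a - a) ∈
          augPow ι (k + 1) := by
        induction l with
        | zero => simp
        | succ l ihl =>
          have h5 := add_mem ihl (h1 l)
          have h6 : (ringMap Φ)^[l] (ringMap Φ a - a) =
              (ringMap Φ)^[l + 1] a - (ringMap Φ)^[l] a := by
            rw [Function.iterate_succ_apply, iterate_map_sub]
          rw [h6] at h5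
          convert h5 using 1
          push_cast
          rw [add_smul, one_smul]
          abel
      have h7 := neg_mem (h4 m)
      rwa [hpow', sub_self, zero_sub, neg_neg] at h7
  refine MulEquiv.ext fun x ↦ eq_of_forall_sub_mem_augPow fun k ↦ ?_
  simpa only [ringMap_of, MulAut.one_apply] using main k (of ℤ _ x)

/-- Only the trivial element of a free group is infinitely divisible by a fixed integer. -/
lemma eq_one_of_forall_exists_pow_eq [Fintype ι] {N : ℕ} (hN : 1 < N) {x : FreeGroup ι}
    (h : ∀ j : ℕ, ∃ y, y ^ N ^ j = x) : x = 1 := by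
  have hpow {y : FreeGroup ι} {l : ℕ} (hy : of ℤ _ y - 1 ∈ augPow ι l) (M : ℕ) :
      of ℤ _ (y ^ M) - 1 ∈ augPow ι l ∧
        of ℤ _ (y ^ M) - 1 - (M : ℤ) • (of ℤ _ y - 1) ∈ augPow ι (l + l) := by
    induction M with
    | zero => simp [-of_apply]
    | succ M ih =>
      have e : of ℤ _ (y ^ (M + 1)) - 1 =
          (of ℤ _ (y ^ M) - 1) * (of ℤ _ y - 1) + (of ℤ _ (y ^ M) - 1) + (of ℤ _ y - 1) := by
        rw [pow_succ, map_mul]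
        noncomm_ring
      have hm := augPow_mul ih.1 hy
      refine ⟨?_, ?_⟩
      · rw [e]
        exact add_mem (add_mem (augPow_antitone (Nat.le_add_left l l) hm) ih.1) hy
      · have := add_mem hm ih.2
        rw [e]
        convert this using 1
        push_cast
        rw [add_smul, one_smul]
        abel
  refine eq_one_of_forall_mem_augPow fun k ↦ ?_
  induction k with
  | zero => exact mem_augPow_zero _
  | succ k ih =>
    rcases Nat.eq_zero_or_pos k with rfl | hk
    · exact of_sub_one_mem_augPow_one x
    refine mem_augPow_of_forall_exists (N := N) (by exact_mod_cast hN) fun j ↦ ?_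
    obtain ⟨y, hy⟩ := h j
    have hyk : ∀ l, l ≤ k → of ℤ _ y - 1 ∈ augPow ι l := by
      intro l
      induction l with
      | zero => exact fun _ ↦ mem_augPow_zero _
      | succ l ihl =>
        intro hl
        rcases Nat.eq_zero_or_pos l with rfl | hl0
        · exact of_sub_one_mem_augPow_one y
        have h1 := (hpow (ihl (by omega)) (N ^ j)).2
        rw [hy] at h1
        have h2 := sub_mem (augPow_antitone hl ih)
          (augPow_antitone (show l + 1 ≤ l + l by omega) h1)
        rw [sub_sub_cancel] at h2
        refine mem_augPow_of_zsmul_mem ?_ h2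
        exact_mod_cast pow_ne_zero j (by omega)
    refine ⟨of ℤ _ y - 1, ?_⟩
    have h1 := (hpow (hyk k le_rfl) (N ^ j)).2
    rw [hy] at h1
    push_cast at h1
    exact augPow_antitone (show k + 1 ≤ k + k by omega) h1

end ResidualNilpotence

section Minkowski

lemma exists_one_add_pow_eq {R : Type*} [Ring R] (B : R) (p : ℕ) :
    ∃ D, (1 + B) ^ p = 1 + (p : ℤ) • B + B * B * D := by
  induction p with
  | zero => exact ⟨0, by simp⟩
  | succ p ih =>
    obtain ⟨D, hD⟩ := ih
    refine ⟨D + D * B + (p : ℤ) • 1, ?_⟩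
    rw [pow_succ, hD]
    push_cast
    simp only [add_smul, one_smul, mul_add, add_mul, mul_one, one_mul, smul_mul_assoc,
      mul_smul_comm, mul_assoc]
    abel

/-- Minkowski's lemma for elements of prime order congruent to `1` modulo `3`. -/
lemma exists_pow_three_smul_of_pow_prime_eq_one {R : Type*} [Ring R] [Module.IsTorsionFree ℤ R]
    {p : ℕ} (hp : p.Prime) {B : R} (hB : ∃ C, B = (3 : ℤ) • C) (hpow : (1 + B) ^ p = 1) (m : ℕ) :
    ∃ C, B = (3 : ℤ) ^ (m + 1) • C := by
  induction m with
  | zero => simpa using hB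
  | succ m ih =>
    obtain ⟨C, hC⟩ := ih
    suffices h : ∃ E, C = (3 : ℤ) • E by
      obtain ⟨E, hE⟩ := h
      exact ⟨E, by rw [hC, hE, smul_smul, ← pow_succ]⟩
    by_cases h3 : p = 3
    · subst h3
      have h1 : (3 : ℤ) ^ (m + 2) • (C + (3 : ℤ) ^ (m + 1) • (C * C) +
          (3 : ℤ) ^ (2 * m + 1) • (C * C * C)) = 0 := by
        have e : (1 + B) ^ 3 - 1 = (3 : ℤ) • B + (3 : ℤ) • (B * B) + B * B * B := by noncomm_ring
        rw [hpow, sub_self, hC] at e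
        rw [e]
        simp only [smul_add, smul_mul_assoc, mul_smul_comm, smul_smul]
        ring_nf
      have h2 := (smul_eq_zero.1 h1).resolve_left (by positivity)
      refine ⟨-((3 : ℤ) ^ m • (C * C) + (3 : ℤ) ^ (2 * m) • (C * C * C)), ?_⟩
      rw [smul_neg, smul_add, smul_smul, smul_smul, ← pow_succ', ← pow_succ', eq_neg_iff_add_eq_zero,
        ← h2]
      abel
    · obtain ⟨D, hD⟩ := exists_one_add_pow_eq B p
      rw [hpow, add_assoc, left_eq_add] at hD
      have h1 : (3 : ℤ) ^ (m + 1) • ((p : ℤ) • C + (3 : ℤ) ^ (m + 1) • (C * C * D)) = 0 := by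
        rw [hC] at hD
        rw [← hD]
        simp only [smul_add, smul_mul_assoc, mul_smul_comm, smul_smul]
        ring_nf
      have h2 := (smul_eq_zero.1 h1).resolve_left (by positivity)
      have hco : IsCoprime (p : ℤ) 3 := by
        rw [show (3 : ℤ) = ((3 : ℕ) : ℤ) from rfl, Nat.isCoprime_iff_coprime]
        exact (Nat.coprime_primes hp Nat.prime_three).2 h3
      obtain ⟨u, v, huv⟩ := hco
      refine ⟨v • C - u • (3 : ℤ) ^ m • (C * C * D), ?_⟩
      have h4 : C = u • (p : ℤ) • C + v • (3 : ℤ) • C := by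
        rw [smul_smul, smul_smul, ← add_smul, huv, one_smul]
      rw [eq_neg_of_add_eq_zero_left h2] at h4
      conv_lhs => rw [h4]
      rw [smul_sub, smul_neg, pow_succ']
      simp only [smul_smul]
      rw [mul_comm v 3, neg_add_eq_sub]
      ring_nf

/-- Minkowski's lemma: an integral matrix of finite order congruent to `1` modulo `3`
is trivial. -/
lemma matrix_eq_one_of_pow_eq_one {ι : Type*} [Fintype ι] [DecidableEq ι] {k : ℕ} (hk : k ≠ 0)
    {A : Matrix ι ι ℤ} (hA : ∀ i j, (3 : ℤ) ∣ (A - 1) i j) (hpow : A ^ k = 1) : A = 1 := by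
  have hprime {p : ℕ} (hp : p.Prime) {A : Matrix ι ι ℤ} (hA : ∃ C, A - 1 = (3 : ℤ) • C)
      (hpow : A ^ p = 1) : A = 1 := by
    ext i j
    rw [← sub_eq_zero]
    by_contra h0
    obtain ⟨C, hC⟩ := exists_pow_three_smul_of_pow_prime_eq_one hp hA
      (by rwa [add_sub_cancel]) ((A - 1) i j).natAbs
    have h1 : (A - 1) i j = (3 : ℤ) ^ (((A - 1) i j).natAbs + 1) * C i j :=
      congrFun (congrFun hC i) j
    have h2 : (A - 1) i j ≠ 0 := h0
    generalize (A - 1) i j = a at h1 h2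
    have h3 := Nat.le_of_dvd (Int.natAbs_pos.2 h2) (Int.natAbs_dvd_natAbs.2 (Dvd.intro _ h1.symm))
    rw [Int.natAbs_pow, show (3 : ℤ).natAbs = 3 from rfl] at h3
    have h4 : a.natAbs + 1 < 3 ^ (a.natAbs + 1) := Nat.lt_pow_self (by norm_num)
    omega
  have hA' : ∃ C, A - 1 = (3 : ℤ) • C := by
    choose C hC using hA
    exact ⟨Matrix.of C, by ext i j; simpa using hC i j⟩
  clear hA
  induction k using Nat.strong_induction_on generalizing A with
  | _ k ih =>
    by_cases h1 : k = 1
    · simpa [h1] using hpow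
    obtain ⟨p, hp, l, rfl⟩ := Nat.exists_prime_and_dvd h1
    have hl : l ≠ 0 := right_ne_zero_of_mul hk
    refine ih l (by nlinarith [hp.two_le, Nat.pos_of_ne_zero hl]) hl ?_ hA'
    refine hprime hp ?_ (by rw [← pow_mul, mul_comm, hpow])
    obtain ⟨C, hC⟩ := hA'
    obtain ⟨D, hD⟩ := exists_one_add_pow_eq (A - 1) l
    rw [add_sub_cancel, add_assoc] at hD
    refine ⟨(l : ℤ) • C + C * (A - 1) * D, ?_⟩
    rw [hD, add_sub_cancel_left, smul_add, smul_comm]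
    conv_lhs => rw [hC]
    conv_rhs => rw [hC]
    simp only [smul_mul_assoc]

variable {ι : Type*} [DecidableEq ι]

/-- The exponent sum of a generator, as a homomorphism. -/
noncomputable def expSum (i : ι) : FreeGroup ι →* Multiplicative ℤ where
  toFun x := Multiplicative.ofAdd (aug _ (fox i (of ℤ _ x)))
  map_one' := by rw [map_one, fox_one, map_zero, ofAdd_zero]
  map_mul' x y := by rw [fox_of_mul, map_add, map_mul, aug_of, one_mul, ofAdd_add]

/-- The matrix of the action of an automorphism of a free group on the abelianization. -/
noncomputable def abMatrix (Φ : MulAut (FreeGroup ι)) : Matrix ι ι ℤ :=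
  Matrix.of fun j i ↦ aug _ (fox i (of ℤ _ (Φ (FreeGroup.of j))))

lemma abMatrix_apply (Φ : MulAut (FreeGroup ι)) (j i : ι) :
    abMatrix Φ j i = aug _ (fox i (of ℤ _ (Φ (FreeGroup.of j)))) := rfl

lemma abMatrix_conj (g : FreeGroup ι) : abMatrix (MulAut.conj g) = 1 := by
  ext j i
  have h : (expSum i (g * FreeGroup.of j * g⁻¹)).toAdd = (expSum i (FreeGroup.of j)).toAdd := by
    rw [(expSum i).map_mul, (expSum i).map_mul, map_inv, mul_comm (expSum i g),
      mul_inv_cancel_right]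
  have h' : aug _ (fox i (of ℤ _ (g * FreeGroup.of j * g⁻¹))) =
    aug _ (fox i (of ℤ _ (FreeGroup.of j))) := h
  rw [abMatrix_apply, MulAut.conj_apply, h', fox_of_of, Matrix.one_apply]
  by_cases hij : i = j
  · simp [hij]
  · simp [hij, Ne.symm hij]

lemma abMatrix_mul [Fintype ι] (Φ Ψ : MulAut (FreeGroup ι)) :
    abMatrix (Φ * Ψ) = abMatrix Ψ * abMatrix Φ := by
  ext j i
  rw [abMatrix_apply, MulAut.mul_apply, ← ringMap_of, fox_ringMap, map_sum, Matrix.mul_apply]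
  simp only [map_mul, aug_ringMap, abMatrix_apply]

lemma abMatrix_pow [Fintype ι] (Φ : MulAut (FreeGroup ι)) (k : ℕ) :
    abMatrix (Φ ^ k) = abMatrix Φ ^ k := by
  induction k with
  | zero => rw [pow_zero, pow_zero, ← map_one MulAut.conj, abMatrix_conj]
  | succ k ih => rw [pow_succ', abMatrix_mul, ih, pow_succ]

lemma dvd_abMatrix_sub_one {Φ : MulAut (FreeGroup ι)}
    (hΦ : ∀ x : FreeGroup ι, ∃ y : Abelianization (FreeGroup ι),
      Abelianization.of (Φ x) = Abelianization.of x * y ^ 3) (j i : ι) :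
    (3 : ℤ) ∣ (abMatrix Φ - 1) j i := by
  obtain ⟨y, hy⟩ := hΦ (FreeGroup.of j)
  have h := congrArg (fun z ↦ (Abelianization.lift (expSum i) z).toAdd) hy
  simp only [Abelianization.lift_apply_of, map_mul, map_pow, toAdd_mul, toAdd_pow] at h
  have h1 : abMatrix Φ j i = (1 : Matrix ι ι ℤ) j i +
      3 • (Abelianization.lift (expSum i) y).toAdd := by
    rw [← abMatrix_conj 1, map_one]
    exact h
  rw [Matrix.sub_apply, h1, add_sub_cancel_left, nsmul_eq_mul]
  exact Dvd.intro _ rfl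

end Minkowski

section HattoriStallings

section Frobenius

variable {R W : Type*} [Ring R] [AddCommGroup W] {τ : R →+ W}

lemma tracial_coeff_mul_comm (hτ : ∀ x y, τ (x * y) = τ (y * x)) (m : ℕ) (f g : Polynomial R) :
    τ ((f * g).coeff m) = τ ((g * f).coeff m) := by
  rw [Polynomial.coeff_mul, Polynomial.coeff_mul, map_sum, map_sum,
    ← Finset.Nat.sum_antidiagonal_swap]
  exact Finset.sum_congr rfl fun p _ ↦ hτ _ _

lemma tracial_coeff_derivative_pow (hτ : ∀ x y, τ (x * y) = τ (y * x)) (m : ℕ)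
    (P : Polynomial R) (k l : ℕ) :
    τ ((Polynomial.derivative (P ^ (k + 1)) * P ^ l).coeff m) =
      (k + 1) • τ ((P ^ (k + l) * Polynomial.derivative P).coeff m) := by
  induction k generalizing l with
  | zero => rw [zero_add, pow_one, zero_add, one_smul, tracial_coeff_mul_comm hτ]
  | succ k ih =>
    rw [pow_succ P (k + 1), Polynomial.derivative_mul, add_mul, mul_assoc, ← pow_succ',
      Polynomial.coeff_add, map_add, ih, tracial_coeff_mul_comm hτ m _ (P ^ l), ← mul_assoc,
      ← pow_add, succ_nsmul _ (k + 1), add_left_comm l, add_comm l, ← add_assoc,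
      add_right_comm k]

/-- The `q`-th power map is additive modulo commutators and modulo the prime `q`. -/
lemma tracial_add_pow_prime (hτ : ∀ x y, τ (x * y) = τ (y * x)) {q : ℕ} (hq : q.Prime)
    (hW : ∀ w : W, q • w = 0) (a b : R) : τ ((a + b) ^ q) = τ (a ^ q) + τ (b ^ q) := by
  set P : Polynomial R := Polynomial.C a + Polynomial.C b * Polynomial.X with hP
  have hdeg : P.natDegree ≤ 1 := by
    rw [hP, add_comm]
    exact Polynomial.natDegree_linear_le
  have h0 : P.coeff 0 = a := by simp [hP]
  have h1 : P.coeff 1 = b := by simp [hP, Polynomial.coeff_C]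
  have hmid (m : ℕ) (hm : m + 1 < q) : τ ((P ^ q).coeff (m + 1)) = 0 := by
    obtain ⟨k, rfl⟩ : ∃ k, q = k + 1 := ⟨q - 1, by omega⟩
    have h := tracial_coeff_derivative_pow hτ m P k 0
    rw [pow_zero, mul_one, hW, Polynomial.coeff_derivative, ← Nat.cast_succ, ← nsmul_eq_mul',
      map_nsmul] at h
    have hd := Nat.dvd_gcd (addOrderOf_dvd_of_nsmul_eq_zero h)
      (addOrderOf_dvd_of_nsmul_eq_zero (hW (τ ((P ^ (k + 1)).coeff (m + 1)))))
    rw [Nat.gcd_comm, (Nat.coprime_of_lt_prime (Nat.succ_ne_zero m) hm hq), Nat.dvd_one] at hd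
    exact AddMonoid.addOrderOf_eq_one_iff.1 hd
  have hev : (a + b) ^ q = (P ^ q).eval 1 := by
    let e : Polynomial R →+* R :=
      Polynomial.eval₂RingHom' (RingHom.id R) 1 fun a ↦ Commute.one_right a
    have he (p : Polynomial R) : e p = p.eval 1 := rfl
    rw [← he, map_pow, he]
    simp [hP]
  have hdegq : (P ^ q).natDegree < q + 1 :=
    Nat.lt_succ_of_le ((Polynomial.natDegree_pow_le_of_le q hdeg).trans (by omega))
  rw [hev, Polynomial.eval_eq_sum_range' hdegq, Finset.sum_range_succ]
  obtain ⟨k, rfl⟩ : ∃ k, q = k + 1 := ⟨q - 1, by have := hq.pos; omega⟩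
  rw [Finset.sum_range_succ']
  simp only [one_pow, mul_one, map_add, map_sum]
  rw [Finset.sum_eq_zero fun i hi ↦ hmid i (by simpa using hi), zero_add]
  congr 2
  · rw [← h0]
    exact map_pow Polynomial.constantCoeff P (k + 1)
  · have := Polynomial.coeff_pow_of_natDegree_le (m := k + 1) hdeg
    rwa [mul_one, h1] at this

end Frobenius

section ConjTrace

variable {G : Type*} [Group G]

/-- The universal trace of the group ring with values in the free `ℤ/q`-module on the
conjugacy classes. -/
noncomputable def conjTrace (q : ℕ) : GroupRing G →+ (ConjClasses G →₀ ZMod q) :=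
  ((MonoidAlgebra.coeffAddEquiv (R := ℤ) (M := G)).toAddMonoidHom : _ →+ _) |>
    (Finsupp.linearCombination ℤ fun x ↦
      Finsupp.single (ConjClasses.mk x) (1 : ZMod q)).toAddMonoidHom.comp

lemma conjTrace_of (q : ℕ) (x : G) :
    conjTrace q (of ℤ G x) = Finsupp.single (ConjClasses.mk x) 1 := by
  simp [conjTrace]

lemma conjTrace_mul_comm (q : ℕ) (a b : GroupRing G) :
    conjTrace q (a * b) = conjTrace q (b * a) := by
  refine addHom_eq_of_of (f := (conjTrace q).comp (AddMonoidHom.mulRight b))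
    (g := (conjTrace q).comp (AddMonoidHom.mulLeft b)) (fun x ↦ ?_) a
  refine addHom_eq_of_of (f := (conjTrace q).comp (AddMonoidHom.mulLeft (of ℤ G x)))
    (g := (conjTrace q).comp (AddMonoidHom.mulRight (of ℤ G x))) (fun y ↦ ?_) b
  simp only [AddMonoidHom.coe_comp, Function.comp_apply, AddMonoidHom.coe_mulLeft,
    AddMonoidHom.coe_mulRight, ← map_mul]
  rw [conjTrace_of, conjTrace_of, ConjClasses.mk_eq_mk_iff_isConj.2]
  exact isConj_iff.2 ⟨y, by group⟩

/-- The Hattori–Stallings trace of a square matrix over the group ring, modulo `q`. -/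
noncomputable def matrixTrace {ι : Type*} [Fintype ι] (q : ℕ) :
    Matrix ι ι (GroupRing G) →+ (ConjClasses G →₀ ZMod q) :=
  (conjTrace q).comp (Matrix.traceAddMonoidHom ι (GroupRing G))

lemma matrixTrace_apply {ι : Type*} [Fintype ι] (q : ℕ) (A : Matrix ι ι (GroupRing G)) :
    matrixTrace q A = conjTrace q A.trace := rfl

lemma matrixTrace_mul_comm {ι κ : Type*} [Fintype ι] [Fintype κ] (q : ℕ)
    (A : Matrix ι κ (GroupRing G)) (B : Matrix κ ι (GroupRing G)) :
    matrixTrace q (A * B) = matrixTrace q (B * A) := by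
  simp only [matrixTrace_apply, Matrix.trace, Matrix.diag, Matrix.mul_apply, map_sum]
  rw [Finset.sum_comm]
  exact Finset.sum_congr rfl fun _ _ ↦ Finset.sum_congr rfl fun _ _ ↦ conjTrace_mul_comm q _ _

/-- The map induced on conjugacy classes by `x ↦ x ^ q`. -/
def powClass (q : ℕ) : ConjClasses G → ConjClasses G :=
  Quotient.map (· ^ q) fun _ _ h ↦ h.pow q

@[simp]
lemma powClass_mk (q : ℕ) (x : G) : powClass q (ConjClasses.mk x) = ConjClasses.mk (x ^ q) := rfl

/-- The Frobenius property of the Hattori–Stallings trace. -/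
lemma matrixTrace_pow_prime {ι : Type*} [Fintype ι] [DecidableEq ι] {q : ℕ} (hq : q.Prime)
    (A : Matrix ι ι (GroupRing G)) :
    matrixTrace q (A ^ q) = Finsupp.mapDomain (powClass q) (matrixTrace q A) := by
  have hadd (A B : Matrix ι ι (GroupRing G)) :
      matrixTrace q ((A + B) ^ q) = matrixTrace q (A ^ q) + matrixTrace q (B ^ q) :=
    tracial_add_pow_prime (matrixTrace_mul_comm q) hq (fun w ↦ by
      ext c
      simp) A B
  let f : Matrix ι ι (GroupRing G) →+ (ConjClasses G →₀ ZMod q) :=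
    AddMonoidHom.mk' (fun A ↦ matrixTrace q (A ^ q)) hadd
  suffices h : f = (Finsupp.mapDomain.addMonoidHom (powClass q)).comp (matrixTrace q) from
    DFunLike.congr_fun h A
  refine Matrix.ext_addMonoidHom fun i j ↦ ?_
  refine AddMonoidHom.ext fun a ↦ addHom_eq_of_of (fun x ↦ ?_) a
  change matrixTrace q ((Matrix.single i j (of ℤ G x)) ^ q) =
    Finsupp.mapDomain (powClass q) (matrixTrace q (Matrix.single i j (of ℤ G x)))
  obtain rfl | hij := eq_or_ne i j
  · have hpow (m : ℕ) : (Matrix.single i i (of ℤ G x)) ^ (m + 1) =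
        Matrix.single i i (of ℤ G (x ^ (m + 1))) := by
      induction m with
      | zero => rw [zero_add, pow_one, pow_one]
      | succ m ih => rw [pow_succ, ih, Matrix.single_mul_single_same, ← map_mul, ← pow_succ]
    obtain ⟨k, rfl⟩ : ∃ k, q = k + 1 := ⟨q - 1, by have := hq.pos; omega⟩
    rw [hpow, matrixTrace_apply, matrixTrace_apply, Matrix.trace_single_eq_same,
      Matrix.trace_single_eq_same, conjTrace_of, conjTrace_of, Finsupp.mapDomain_single,
      powClass_mk]
  · have hsq : (Matrix.single i j (of ℤ G x)) ^ q = 0 := by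
      obtain ⟨k, rfl⟩ : ∃ k, q = k + 2 := ⟨q - 2, by have := hq.two_le; omega⟩
      rw [pow_add, pow_two, Matrix.single_mul_single_of_ne _ _ _ _ hij.symm, mul_zero]
    rw [hsq, map_zero, matrixTrace_apply, Matrix.trace_single_eq_of_ne _ _ _ hij, map_zero,
      Finsupp.mapDomain_zero]

end ConjTrace

end HattoriStallings

section Reidemeister

section ConjRing

variable {G : Type*} [Group G]

/-- The map from the group ring of `G` to that of its automorphism group induced by
conjugation. -/
noncomputable def conjRing : GroupRing G →+* GroupRing (MulAut G) :=
  MonoidAlgebra.mapDomainRingHom ℤ (MulAut.conj : G →* MulAut G)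

@[simp]
lemma conjRing_of (x : G) : conjRing (of ℤ G x) = of ℤ _ (MulAut.conj x) := by
  simp [conjRing]

lemma aug_conjRing (a : GroupRing G) : aug _ (conjRing a) = aug _ a := by
  refine addHom_eq_of_of (f := (aug _).toRingHom.toAddMonoidHom.comp conjRing.toAddMonoidHom)
    (g := (aug G).toRingHom.toAddMonoidHom) (fun x ↦ ?_) a
  simp [-of_apply]

lemma mul_conj_eq (ψ : MulAut G) (x : G) : ψ * MulAut.conj x = MulAut.conj (ψ x) * ψ := by
  ext y
  simp

lemma of_mul_conjRing (ψ : MulAut G) (a : GroupRing G) :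
    of ℤ _ ψ * conjRing a = conjRing (ringMap ψ a) * of ℤ _ ψ := by
  refine addHom_eq_of_of (f := (AddMonoidHom.mulLeft (of ℤ _ ψ)).comp conjRing.toAddMonoidHom)
    (g := (AddMonoidHom.mulRight (of ℤ _ ψ)).comp
      (conjRing.toAddMonoidHom.comp (ringMap ψ).toAddMonoidHom)) (fun x ↦ ?_) a
  change of ℤ _ ψ * conjRing (of ℤ G x) = conjRing (ringMap ψ (of ℤ G x)) * of ℤ _ ψ
  rw [ringMap_of, conjRing_of, conjRing_of, ← map_mul, ← map_mul, mul_conj_eq]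

lemma conjRing_mul_of_inv (ψ : MulAut G) (a : GroupRing G) :
    conjRing a * of ℤ _ ψ⁻¹ = of ℤ _ ψ⁻¹ * conjRing (ringMap ψ a) := by
  have h := congrArg (fun z ↦ of ℤ _ ψ⁻¹ * z * of ℤ _ ψ⁻¹) (of_mul_conjRing ψ a)
  rwa [← mul_assoc, ← map_mul, inv_mul_cancel, map_one, one_mul, mul_assoc, mul_assoc, ← map_mul,
    mul_inv_cancel, map_one, mul_one] at h

end ConjRing

variable {ι : Type*} [DecidableEq ι]

/-- The Jacobian matrix of Fox derivatives of an automorphism `ψ` of a free group, multiplied by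
`ψ⁻¹`, as a matrix over the group ring of the automorphism group. -/
noncomputable def jacobian (ψ : MulAut (FreeGroup ι)) :
    Matrix ι ι (GroupRing (MulAut (FreeGroup ι))) :=
  Matrix.of fun j i ↦ of ℤ _ ψ⁻¹ * conjRing (fox i (of ℤ _ (ψ (FreeGroup.of j))))

lemma jacobian_apply (ψ : MulAut (FreeGroup ι)) (j i : ι) :
    jacobian ψ j i = of ℤ _ ψ⁻¹ * conjRing (fox i (of ℤ _ (ψ (FreeGroup.of j)))) := rfl

lemma jacobian_mul [Fintype ι] (φ ψ : MulAut (FreeGroup ι)) :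
    jacobian (φ * ψ) = jacobian ψ * jacobian φ := by
  ext1 j i
  rw [jacobian_apply, MulAut.mul_apply, ← ringMap_of, fox_ringMap, map_sum, Matrix.mul_apply,
    Finset.mul_sum]
  refine Finset.sum_congr rfl fun k _ ↦ ?_
  rw [jacobian_apply, jacobian_apply, mul_inv_rev, map_mul, map_mul, mul_assoc, mul_assoc,
    ← mul_assoc (conjRing _) (of ℤ _ φ⁻¹), conjRing_mul_of_inv, mul_assoc]

lemma jacobian_one : jacobian (1 : MulAut (FreeGroup ι)) = 1 := by
  ext1 j i
  rw [jacobian_apply, inv_one, map_one, one_mul, MulAut.one_apply, fox_of_of, Matrix.one_apply]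
  by_cases hij : i = j
  · simp only [hij, if_true, map_one]
  · simp only [hij, Ne.symm hij, if_false, map_zero]

lemma jacobian_pow [Fintype ι] (ψ : MulAut (FreeGroup ι)) (k : ℕ) :
    jacobian (ψ ^ k) = jacobian ψ ^ k := by
  induction k with
  | zero => rw [pow_zero, pow_zero, jacobian_one]
  | succ k ih => rw [pow_succ', jacobian_mul, ih, pow_succ]

/-- The column of the elements `xⱼ - 1`, for the generators `xⱼ` of the free group. -/
noncomputable def generatorColumn (ι : Type*) :
    Matrix ι Unit (GroupRing (MulAut (FreeGroup ι))) :=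
  Matrix.of fun j _ ↦ conjRing (of ℤ _ (FreeGroup.of j) - 1)

/-- The row of Fox derivatives of `g`, multiplied by `g⁻¹`. -/
noncomputable def foxRow (g : FreeGroup ι) : Matrix Unit ι (GroupRing (MulAut (FreeGroup ι))) :=
  Matrix.of fun _ i ↦ conjRing (of ℤ _ g⁻¹ * fox i (of ℤ _ g))

lemma foxRow_mul_generatorColumn [Fintype ι] (g : FreeGroup ι) :
    foxRow g * generatorColumn ι = Matrix.of fun _ _ ↦ 1 - conjRing (of ℤ _ g⁻¹) := by
  ext1 _ _
  have h := (eq_sub_of_add_eq' (fox_fundamental (of ℤ _ g)).symm)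
  simp only [Matrix.mul_apply, foxRow, generatorColumn, Matrix.of_apply, ← map_mul, ← map_sum,
    mul_assoc, ← Finset.mul_sum, h]
  rw [aug_of, one_smul, mul_sub, ← map_mul, inv_mul_cancel, map_one, mul_one, map_sub, map_one]

lemma jacobian_conj (g : FreeGroup ι) :
    jacobian (MulAut.conj g) = 1 - generatorColumn ι * foxRow g := by
  ext1 j i
  have h : of ℤ _ g⁻¹ * fox i (of ℤ _ (g * FreeGroup.of j * g⁻¹)) =
      (if j = i then 1 else 0) -
        (of ℤ _ (FreeGroup.of j) - 1) * (of ℤ _ g⁻¹ * fox i (of ℤ _ g)) := by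
    have hg : of ℤ _ g⁻¹ * of ℤ _ g = 1 := by rw [← map_mul, inv_mul_cancel, map_one]
    simp only [mul_assoc g, fox_of_mul, fox_of_inv, fox_of_of]
    rw [mul_add, ← mul_assoc _ (of ℤ _ g), hg, one_mul]
    simp only [eq_comm (a := i)]
    noncomm_ring
  rw [jacobian_apply, ← map_inv, ← conjRing_of, ← map_mul, MulAut.conj_apply, h, map_sub, map_mul,
    Matrix.sub_apply, Matrix.one_apply, Matrix.mul_apply]
  simp only [generatorColumn, foxRow, Matrix.of_apply, Finset.univ_unique, Finset.sum_singleton]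
  split_ifs <;> simp only [map_one, map_zero]

lemma jacobian_mul_generatorColumn [Fintype ι] (ψ : MulAut (FreeGroup ι)) :
    jacobian ψ * generatorColumn ι =
      generatorColumn ι *
        (Matrix.of fun _ _ ↦ of ℤ _ ψ⁻¹ : Matrix Unit Unit (GroupRing (MulAut (FreeGroup ι)))) := by
  ext1 j _
  have h := (eq_sub_of_add_eq' (fox_fundamental (of ℤ _ (ψ (FreeGroup.of j)))).symm)
  simp only [Matrix.mul_apply, jacobian_apply, generatorColumn, Matrix.of_apply, mul_assoc,
    ← map_mul conjRing, ← map_sum, ← Finset.mul_sum, h]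
  rw [aug_of, one_smul, Finset.univ_unique, Finset.sum_singleton, conjRing_mul_of_inv,
    map_sub (ringMap ψ), ringMap_of, map_one]

/-- The Reidemeister trace of an automorphism of a free group, modulo `q`. -/
noncomputable def reidemeister [Fintype ι] (q : ℕ) (ψ : MulAut (FreeGroup ι)) :
    ConjClasses (MulAut (FreeGroup ι)) →₀ ZMod q :=
  conjTrace q (of ℤ _ ψ⁻¹) - matrixTrace q (jacobian ψ)

lemma reidemeister_mul_conj [Fintype ι] (q : ℕ) (ψ : MulAut (FreeGroup ι)) (g : FreeGroup ι) :
    reidemeister q (ψ * MulAut.conj g) = reidemeister q ψ := by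
  have h : matrixTrace q (generatorColumn ι * foxRow g * jacobian ψ) =
      conjTrace q (of ℤ _ ψ⁻¹) - conjTrace q (of ℤ _ (ψ * MulAut.conj g)⁻¹) := by
    rw [Matrix.mul_assoc, matrixTrace_mul_comm, Matrix.mul_assoc, jacobian_mul_generatorColumn,
      ← Matrix.mul_assoc, foxRow_mul_generatorColumn, matrixTrace_apply, ← map_sub]
    congr 1
    simp only [Matrix.trace, Matrix.diag, Matrix.mul_apply, Matrix.of_apply, Finset.univ_unique,
      Finset.sum_singleton]
    rw [sub_mul, one_mul, conjRing_of, ← map_mul, mul_inv_rev, map_inv MulAut.conj]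
  rw [reidemeister, jacobian_mul, jacobian_conj, sub_mul, one_mul, map_sub, h, reidemeister]
  abel

lemma mapDomain_reidemeister [Fintype ι] {q : ℕ} (hq : q.Prime) (ψ : MulAut (FreeGroup ι)) :
    Finsupp.mapDomain (powClass q) (reidemeister q ψ) = reidemeister q (ψ ^ q) := by
  rw [reidemeister, reidemeister, jacobian_pow, matrixTrace_pow_prime hq, conjTrace_of,
    conjTrace_of, ← inv_pow, ← powClass_mk, ← Finsupp.mapDomain_single (f := powClass q)]
  exact map_sub (Finsupp.mapDomain.addMonoidHom (M := ZMod q)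
    (powClass (G := MulAut (FreeGroup ι)) q)) _ _

lemma linearCombination_conjTrace {G : Type*} [Group G] (q : ℕ) (a : GroupRing G) :
    Finsupp.linearCombination (ZMod q) (fun _ ↦ (1 : ZMod q)) (conjTrace q a) = aug G a := by
  refine addHom_eq_of_of
    (f := (Finsupp.linearCombination (ZMod q) fun _ ↦ (1 : ZMod q)).toAddMonoidHom.comp
      (conjTrace q))
    (g := (Int.castAddHom (ZMod q)).comp (aug G).toRingHom.toAddMonoidHom) (fun x ↦ ?_) a
  change Finsupp.linearCombination (ZMod q) (fun _ ↦ (1 : ZMod q)) (conjTrace q (of ℤ G x)) =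
    ((aug G (of ℤ G x) : ℤ) : ZMod q)
  rw [conjTrace_of, aug_of, Finsupp.linearCombination_single, smul_eq_mul, one_mul, Int.cast_one]

lemma linearCombination_reidemeister [Fintype ι] (q : ℕ) (ψ : MulAut (FreeGroup ι)) :
    Finsupp.linearCombination (ZMod q) (fun _ ↦ (1 : ZMod q)) (reidemeister q ψ) =
      ((1 - (abMatrix ψ).trace : ℤ) : ZMod q) := by
  rw [reidemeister, matrixTrace_apply, map_sub, linearCombination_conjTrace,
    linearCombination_conjTrace, aug_of, ← Int.cast_sub]
  simp only [Matrix.trace, Matrix.diag, map_sum, jacobian_apply, map_mul, aug_of, one_mul,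
    aug_conjRing, abMatrix_apply]

lemma conjTrace_mul_conjRing_mem {G : Type*} [Group G] (q : ℕ) (φ : MulAut G)
    (a : GroupRing G) :
    conjTrace q (of ℤ _ φ * conjRing a) ∈ Finsupp.supported (ZMod q) (ZMod q)
      (Set.range fun y : G ↦ ConjClasses.mk (φ * MulAut.conj y)) := by
  induction a using MonoidAlgebra.induction_on with
  | of x =>
    rw [conjRing_of, ← map_mul, conjTrace_of]
    exact Finsupp.single_mem_supported _ _ ⟨x, rfl⟩
  | add x y hx hy =>
    rw [map_add, mul_add, map_add]
    exact add_mem hx hy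
  | smul r x hx =>
    rw [map_zsmul, mul_smul_comm, map_zsmul]
    exact zsmul_mem hx r

lemma exists_of_mem_support_reidemeister [Fintype ι] {q : ℕ} {ψ : MulAut (FreeGroup ι)}
    {c : ConjClasses (MulAut (FreeGroup ι))} (hc : c ∈ (reidemeister q ψ).support) :
    ∃ y : FreeGroup ι, ConjClasses.mk (ψ⁻¹ * MulAut.conj y) = c := by
  have h : reidemeister q ψ ∈ Finsupp.supported (ZMod q) (ZMod q)
      (Set.range fun y : FreeGroup ι ↦ ConjClasses.mk (ψ⁻¹ * MulAut.conj y)) := by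
    refine sub_mem ?_ ?_
    · simpa only [map_one, mul_one] using conjTrace_mul_conjRing_mem q ψ⁻¹ 1
    · rw [matrixTrace_apply, Matrix.trace, map_sum]
      exact sum_mem fun j _ ↦ conjTrace_mul_conjRing_mem q ψ⁻¹ _
  exact h hc

end Reidemeister

section Torsion

lemma conj_eq_one {ι : Type*} [Subsingleton ι] (g : FreeGroup ι) : MulAut.conj g = 1 := by
  suffices h : (MulAut.conj : FreeGroup ι →* MulAut (FreeGroup ι)) = 1 from
    DFunLike.congr_fun h g
  refine FreeGroup.ext_hom _ _ fun i ↦ ?_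
  apply MulEquiv.toMonoidHom_injective
  refine FreeGroup.ext_hom _ _ fun j ↦ ?_
  rw [Subsingleton.elim j i]
  change FreeGroup.of i * FreeGroup.of i * (FreeGroup.of i)⁻¹ = FreeGroup.of i
  rw [mul_inv_cancel_right]

variable {ι : Type*} [DecidableEq ι]

lemma mem_augPow_of_of_mul_eq {i : ι} {a : GroupRing (FreeGroup ι)}
    (ha : of ℤ _ (FreeGroup.of i) * a = a) (k : ℕ) : a ∈ augPow ι k := by
  induction k generalizing a with
  | zero => exact mem_augPow_zero a
  | succ k ih =>
    have h0 : aug _ a = 0 := by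
      have h := congrArg (fun b ↦ aug _ (fox i b)) ha
      simpa only [fox_mul, map_add, map_mul, aug_of, one_mul, fox_of_of, if_true, map_smul,
        map_one, add_eq_right, smul_eq_mul, mul_one, map_zsmul] using h
    refine mem_augPow_succ.2 ⟨h0, fun j ↦ ih ?_⟩
    have h := congrArg (fox j) ha
    rwa [fox_mul, h0, zero_smul, zero_add] at h

/-- A free group of rank at least two has trivial center. -/
lemma conj_injective [Fintype ι] [Nontrivial ι] :
    Function.Injective (MulAut.conj : FreeGroup ι →* MulAut (FreeGroup ι)) := by
  refine (injective_iff_map_eq_one _).2 fun z hz ↦ eq_one_of_forall_mem_augPow fun k ↦ ?_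
  refine augPow_succ_le k (mem_augPow_succ.2 ⟨by rw [map_sub, aug_of, map_one, sub_self],
    fun j ↦ ?_⟩)
  obtain ⟨i, hij⟩ := exists_ne j
  rw [map_sub, fox_one, sub_zero]
  refine mem_augPow_of_of_mul_eq (i := i) ?_ k
  have hcomm : z * FreeGroup.of i = FreeGroup.of i * z :=
    mul_inv_eq_iff_eq_mul.1 (DFunLike.congr_fun hz (FreeGroup.of i))
  have h := congrArg (fun x ↦ fox j (of ℤ _ x)) hcomm
  simp only [fox_of_mul, fox_of_of, hij.symm, if_false, mul_zero, add_zero, zero_add] at h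
  exact h.symm

lemma eq_one_of_pow_eq_one [Fintype ι] {Φ : MulAut (FreeGroup ι)} {m : ℕ} (hm : m ≠ 0)
    (hpow : Φ ^ m = 1) (hΦ : abMatrix Φ = 1) : Φ = 1 := by
  refine eq_one_of_pow_eq_one_of_aug hm hpow fun i j ↦ ?_
  rw [← abMatrix_apply, hΦ, Matrix.one_apply]
  simp only [eq_comm (a := i)]

lemma exists_mul_conj_pow_eq {G : Type*} [Group G] (ψ : MulAut G) (y : G) (k : ℕ) :
    ∃ z, (ψ * MulAut.conj y) ^ k = ψ ^ k * MulAut.conj z := by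
  induction k with
  | zero => exact ⟨1, by rw [pow_zero, pow_zero, map_one, one_mul]⟩
  | succ k ih =>
    obtain ⟨z, hz⟩ := ih
    refine ⟨ψ⁻¹ z * y, ?_⟩
    have h := mul_conj_eq ψ (ψ⁻¹ z)
    rw [MulAut.apply_inv_self] at h
    rw [pow_succ, hz, mul_assoc, ← mul_assoc (MulAut.conj z), ← h, pow_succ, map_mul]
    simp only [mul_assoc]

/-- An outer automorphism of finite order with a representative `c` conjugate to a proper power
of itself has representative `c` of finite order. -/
lemma pow_eq_one_of_isConj_pow [Fintype ι] [Nontrivial ι] {c : MulAut (FreeGroup ι)} {N k : ℕ}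
    (hN : 1 < N) (hc : IsConj c (c ^ N)) {h : FreeGroup ι} (hk : c ^ k = MulAut.conj h) :
    c ^ k = 1 := by
  obtain ⟨θ, hθ⟩ := isConj_iff.1 hc
  have h1 : θ h = h ^ N := by
    refine conj_injective ?_
    rw [map_pow, ← hk, ← pow_mul, mul_comm k, pow_mul, ← hθ, conj_pow, hk, mul_conj_eq,
      mul_inv_cancel_right]
  have h2 (j : ℕ) : (θ ^ j) h = h ^ N ^ j := by
    induction j with
    | zero => rw [pow_zero, pow_zero, pow_one, MulAut.one_apply]
    | succ j ih => rw [pow_succ, MulAut.mul_apply, h1, map_pow, ih, ← pow_mul, ← pow_succ]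
  have h3 : h = 1 := eq_one_of_forall_exists_pow_eq hN fun j ↦
    ⟨(θ ^ j)⁻¹ h, by rw [← map_pow, ← h2, MulAut.inv_apply_self]⟩
  rw [hk, h3, map_one]

lemma exists_iterate_eq_self {α : Type*} [DecidableEq α] {S : Finset α} (hS : S.Nonempty)
    {f : α → α} (hf : S ⊆ S.image f) : ∃ c ∈ S, ∃ m, 0 < m ∧ f^[m] c = c := by
  have h (s : S) : ∃ t : S, f t = s := by
    obtain ⟨t, ht, hts⟩ := Finset.mem_image.1 (hf s.2)
    exact ⟨⟨t, ht⟩, hts⟩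
  choose g hg using h
  have hinj : Function.Injective g := fun s t hst ↦
    Subtype.ext (by rw [← hg s, ← hg t, hst])
  have hiter (m : ℕ) (s : S) : f^[m] (g^[m] s : S) = s := by
    induction m generalizing s with
    | zero => rfl
    | succ m ih => rw [Function.iterate_succ_apply' g, Function.iterate_succ_apply, hg, ih]
  obtain ⟨c, hc⟩ := hS
  obtain ⟨m, hm, hmc⟩ := hinj.mem_periodicPts ⟨c, hc⟩
  refine ⟨c, hc, m, hm, ?_⟩
  have := hiter m ⟨c, hc⟩
  rwa [hmc.eq] at this

lemma powClass_iterate_mk {G : Type*} [Group G] (q m : ℕ) (x : G) :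
    (powClass q)^[m] (ConjClasses.mk x) = ConjClasses.mk (x ^ q ^ m) := by
  induction m with
  | zero => rw [pow_zero, pow_one, Function.iterate_zero, id_eq]
  | succ m ih => rw [Function.iterate_succ_apply', ih, powClass_mk, ← pow_mul, ← pow_succ]

/-- An outer automorphism of a free group of rank at least two which has finite order and acts
trivially on the abelianization has a representative conjugate to a proper power of itself. -/
lemma exists_isConj_pow [Fintype ι] [Nontrivial ι] {Φ : MulAut (FreeGroup ι)}
    (hΦ : abMatrix Φ = 1) {k : ℕ} (hk : k ≠ 0) {g : FreeGroup ι} (hg : Φ ^ k = MulAut.conj g) :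
    ∃ (y : FreeGroup ι) (N : ℕ), 1 < N ∧
      IsConj (Φ⁻¹ * MulAut.conj y) ((Φ⁻¹ * MulAut.conj y) ^ N) := by
  classical
  obtain ⟨q, hq, hcard, hmod⟩ := Nat.exists_prime_gt_modEq_one (Fintype.card ι) hk
  obtain ⟨m, hm⟩ := (Nat.modEq_iff_dvd' hq.one_lt.le).1 hmod.symm
  have hfix : Finsupp.mapDomain (powClass q) (reidemeister q Φ) = reidemeister q Φ := by
    have hpow : Φ ^ q = Φ * MulAut.conj (g ^ m) := by
      rw [map_pow, ← hg, ← pow_mul, ← hm, ← pow_succ', Nat.sub_add_cancel hq.one_lt.le]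
    rw [mapDomain_reidemeister hq, hpow, reidemeister_mul_conj]
  have hne : reidemeister q Φ ≠ 0 := by
    intro h0
    have h := linearCombination_reidemeister q Φ
    rw [h0, map_zero, hΦ, Matrix.trace_one, eq_comm, ZMod.intCast_zmod_eq_zero_iff_dvd,
      dvd_sub_comm] at h
    have h1 : 1 < Fintype.card ι := Fintype.one_lt_card
    have := Int.le_of_dvd (by omega) h
    omega
  have hsub : (reidemeister q Φ).support ⊆ (reidemeister q Φ).support.image (powClass q) := by
    conv_lhs => rw [← hfix]
    exact Finsupp.mapDomain_support
  obtain ⟨c, hc, l, hl, hlc⟩ := exists_iterate_eq_self (Finsupp.support_nonempty_iff.2 hne) hsub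
  obtain ⟨y, rfl⟩ := exists_of_mem_support_reidemeister hc
  rw [powClass_iterate_mk, ConjClasses.mk_eq_mk_iff_isConj] at hlc
  exact ⟨y, q ^ l, Nat.one_lt_pow hl.ne' hq.one_lt, hlc.symm⟩

/-- The kernel of the action of the outer automorphism group of a free group on the
abelianization is torsion free. -/
theorem exists_eq_conj_of_pow_eq_conj [Fintype ι] {Φ : MulAut (FreeGroup ι)}
    (hΦ : abMatrix Φ = 1) {k : ℕ} (hk : k ≠ 0) {g : FreeGroup ι} (hg : Φ ^ k = MulAut.conj g) :
    ∃ h, Φ = MulAut.conj h := by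
  obtain hι | hι := subsingleton_or_nontrivial ι
  · exact ⟨1, by rw [map_one, eq_one_of_pow_eq_one hk (hg.trans (conj_eq_one g)) hΦ]⟩
  · obtain ⟨y, N, hN, hy⟩ := exists_isConj_pow hΦ hk hg
    obtain ⟨z, hz⟩ := exists_mul_conj_pow_eq Φ⁻¹ y k
    rw [inv_pow, hg, ← map_inv, ← map_mul] at hz
    have hinv : abMatrix Φ⁻¹ = 1 := by
      have h := abMatrix_mul Φ⁻¹ Φ
      rw [inv_mul_cancel, hΦ, one_mul, ← map_one MulAut.conj, abMatrix_conj] at h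
      exact h.symm
    have h1 := eq_one_of_pow_eq_one hk (pow_eq_one_of_isConj_pow hN hy hz)
      (by rw [abMatrix_mul, hinv, abMatrix_conj, one_mul])
    exact ⟨y, inv_mul_eq_one.1 h1⟩

end Torsion

end FoxCalculus

/-- `IA_n(ℤ/3)` is torsion free: if an automorphism representing an element of
`IA_n(ℤ/3)` has a positive power which is inner, then it is itself inner. -/
theorem IA3_torsion_free {n : ℕ} (hn : 1 ≤ n)
    (Φ : FreeGroup (Fin n) ≃* FreeGroup (Fin n))
    (hΦ : ActsTriviallyOnH1Mod3 Φ)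
    (hfin : ∃ k : ℕ, 1 ≤ k ∧ ∃ g : FreeGroup (Fin n),
      ∀ x : FreeGroup (Fin n), (Φ ^ k) x = g * x * g⁻¹) :
    ∃ h : FreeGroup (Fin n), ∀ x : FreeGroup (Fin n), Φ x = h * x * h⁻¹ := by
  obtain ⟨k, hk, g, hg⟩ := hfin
  replace hg : (Φ : MulAut (FreeGroup (Fin n))) ^ k = MulAut.conj g := MulEquiv.ext hg
  have hab : FoxCalculus.abMatrix Φ = 1 :=
    FoxCalculus.matrix_eq_one_of_pow_eq_one (Nat.one_le_iff_ne_zero.1 hk)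
      (FoxCalculus.dvd_abMatrix_sub_one hΦ)
      (by rw [← FoxCalculus.abMatrix_pow, hg, FoxCalculus.abMatrix_conj])
  obtain ⟨h, hh⟩ := FoxCalculus.exists_eq_conj_of_pow_eq_conj hab
    (Nat.one_le_iff_ne_zero.1 hk) hg
  exact ⟨h, DFunLike.congr_fun hh⟩
end
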